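/- Let E ⊂ ℝⁿ be Hᵐ-measurable with Hᵐ(E) < ∞, Hᵐ⁺¹(closure E) = 0, and let U ⊂ E be Hᵐ-measurable, purely m-unrectifiable with Hᵐ(U) > 0. Then for every ε with 0 < ε < Hᵐ(U)/4 there exists a Lipschitz map ψ : ℝⁿ → ℝⁿ with sup_x |ψ(x) − x| < ε and Hᵐ(ψ(E)) < Hᵐ(E) − Hᵐ(U)/2. -/

import Mathlib

open MeasureTheory Metric Set Filter ENNReal

noncomputable section

abbrev En (n : ℕ) := EuclideanSpace ℝ (Fin n)

/-- A set `E ⊆ ℝⁿ` is `m`-rectifiable if it is covered, up to an `Hᵐ`-null set,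
by countably many Lipschitz images of `ℝᵐ`. -/
def IsRectifiable (n m : ℕ) (E : Set (En n)) : Prop :=
  ∃ f : ℕ → EuclideanSpace ℝ (Fin m) → En n,
    (∀ i, ∃ L : NNReal, LipschitzWith L (f i)) ∧
    μH[m] (E \ ⋃ i, Set.range (f i)) = 0

/-- A set `U` is purely `m`-unrectifiable if `Hᵐ(U ∩ F) = 0` for every `m`-rectifiable `F`. -/
def PurelyUnrectifiable (n m : ℕ) (U : Set (En n)) : Prop :=
  ∀ F : Set (En n), IsRectifiable n m F → μH[m] (U ∩ F) = 0

open scoped Topology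

lemma measure_le_of_vitali_packing {ι Z : Type*} [MeasurableSpace Z] {m : ℕ} (κ : Measure Z)
    (f : Z → Fin m → ℝ) (P : Set Z) (O : Set (Fin m → ℝ)) (t : Set ι) (x : ι → Fin m → ℝ)
    (r : ι → ℝ) (R : ℝ) (c : ℝ≥0∞) (hrpos : ∀ a ∈ t, 0 < r a) (hrR : ∀ a ∈ t, r a ≤ R)
    (hO : ∀ a ∈ t, closedBall (x a) (r a) ⊆ O)
    (hP : P ⊆ ⋃ a ∈ t, f ⁻¹' closedBall (x a) (r a))
    (hκ : ∀ a ∈ t, κ (P ∩ f ⁻¹' closedBall (x a) (5 * r a)) ≤ c * ENNReal.ofReal ((2 * r a) ^ m)) :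
    κ P ≤ c * volume O := by
  obtain ⟨u, hut, hdisj, hcov⟩ :=
    Vitali.exists_disjoint_subfamily_covering_enlargement_closedBall t x r R hrR 5 (by norm_num)
  have hucount : u.Countable := by
    apply hdisj.countable_of_nonempty_interior
    intro a ha
    refine ⟨x a, ?_⟩
    exact ball_subset_interior_closedBall (mem_ball_self (hrpos a (hut ha)))
  have hPu : P ⊆ ⋃ a ∈ u, P ∩ f ⁻¹' closedBall (x a) (5 * r a) := by
    intro z hz
    obtain ⟨a, hat, hza⟩ := mem_iUnion₂.1 (hP hz)
    obtain ⟨b, hbu, hab⟩ := hcov a hat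
    exact mem_iUnion₂.2 ⟨b, hbu, hz, hab hza⟩
  have := hucount.to_subtype
  calc κ P ≤ κ (⋃ a ∈ u, P ∩ f ⁻¹' closedBall (x a) (5 * r a)) := measure_mono hPu
    _ ≤ ∑' a : u, κ (P ∩ f ⁻¹' closedBall (x a) (5 * r a)) := measure_biUnion_le _ hucount _
    _ ≤ ∑' a : u, c * volume (closedBall (x a) (r a)) := by
        refine ENNReal.tsum_le_tsum fun a => ?_
        refine (hκ a (hut a.2)).trans_eq ?_
        rw [Real.volume_pi_closedBall _ (hrpos a (hut a.2)).le, Fintype.card_fin]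
    _ = c * volume (⋃ a ∈ u, closedBall (x a) (r a)) := by
        rw [ENNReal.tsum_mul_left, measure_biUnion hucount hdisj
          (fun a _ => measurableSet_closedBall)]
    _ ≤ c * volume O := by
        gcongr
        exact iUnion₂_subset fun a ha => hO a (hut ha)

/-- A set of positive upper-density points of infinite order for a finite measure is null. -/
lemma volume_eq_zero_of_infinite_upper_density {m : ℕ} (ν : Measure (Fin m → ℝ))
    [IsFiniteMeasure ν] (S : Set (Fin m → ℝ))
    (h : ∀ p ∈ S, ∀ (M : ℕ) (δ : ℝ), 0 < δ → ∃ r, 0 < r ∧ r < δ ∧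
      M * ENNReal.ofReal (r ^ m) ≤ ν (closedBall p r)) : volume S = 0 := by
  have hae := Besicovitch.ae_tendsto_rnDeriv ν (volume : Measure (Fin m → ℝ))
  have hfin := ν.rnDeriv_lt_top (volume : Measure (Fin m → ℝ))
  suffices ∀ᵐ p : Fin m → ℝ, p ∉ S by
    rw [ae_iff] at this; simpa using this
  filter_upwards [hae, hfin] with p hp hpfin hpS
  obtain ⟨M, hM⟩ := ENNReal.exists_nat_gt hpfin.ne
  have hev := hp.eventually (gt_mem_nhds hM)
  obtain ⟨δ, hδ, hδs⟩ := Metric.mem_nhdsWithin_iff.1 hev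
  obtain ⟨r, hr0, hrδ, hr⟩ := h p hpS (M * 2 ^ m) δ hδ
  have h1 : ν (closedBall p r) / volume (closedBall p r) < M := by
    apply hδs
    refine ⟨?_, hr0⟩
    simpa [abs_of_pos hr0] using hrδ
  rw [Real.volume_pi_closedBall _ hr0.le, Fintype.card_fin,
    ENNReal.div_lt_iff (Or.inl (by positivity)) (Or.inl ENNReal.ofReal_ne_top)] at h1
  refine absurd h1 (not_lt.2 (le_trans (le_of_eq ?_) hr))
  rw [mul_pow, ENNReal.ofReal_mul (by positivity), ENNReal.ofReal_pow (by norm_num)]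
  push_cast
  rw [mul_assoc]
  simp

/-- The points `y ≠ x` at distance at most `r` from `x` along which `f` expands by less
than `s`. -/
def flatCone {X : Type*} [MetricSpace X] {m : ℕ} (f : X → Fin m → ℝ) (x : X) (s r : ℝ) : Set X :=
  {y | 0 < dist y x ∧ dist y x ≤ r ∧ dist (f y) (f x) < s * dist y x}

lemma preimage_closedBall_subset_flatCone_union {X : Type*} [MetricSpace X] {m : ℕ}
    (f : X → Fin m → ℝ) (S : Set X) {s r : ℝ} (hs0 : 0 < s) {x y : X} (hyx : 0 < dist y x)
    (hy : dist (f y) (f x) < s / 4 * dist y x)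
    (hmax : ∀ z ∈ S, dist (f z) (f x) < s / 4 * dist z x → dist z x ≤ 4 / 3 * dist y x)
    (hr : 2 * dist y x ≤ r) :
    S ∩ f ⁻¹' closedBall (f x) (s * dist y x / 8) ⊆
      (S ∩ flatCone f x s r) ∪ (S ∩ flatCone f y s r) := by
  rintro z ⟨hzS, hz⟩
  rw [mem_preimage, mem_closedBall] at hz
  have hsη := mul_pos hs0 hyx
  by_cases hc : dist (f z) (f x) < s * dist z x
  · left
    have hzx : 0 < dist z x := by
      by_contra h0
      have h0' : dist z x = 0 := le_antisymm (not_lt.1 h0) dist_nonneg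
      rw [h0', mul_zero] at hc
      exact absurd hc (not_lt.2 dist_nonneg)
    refine ⟨hzS, hzx, ?_, hc⟩
    by_contra hlt
    push Not at hlt
    have h1 : dist y x < dist z x := by linarith
    have h2 := hmax z hzS (by nlinarith)
    linarith
  · right
    push Not at hc
    have h1 : dist z x ≤ dist y x / 8 := by
      have : s * dist z x ≤ s * (dist y x / 8) := by linarith
      exact le_of_mul_le_mul_left this hs0
    have h2 : dist y x ≤ dist z y + dist z x := by
      rw [dist_comm z y]; exact dist_triangle _ _ _
    have h3 : dist z y ≤ dist z x + dist y x := by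
      rw [dist_comm y x]; exact dist_triangle _ _ _
    have h4 : dist (f z) (f y) ≤ dist (f z) (f x) + dist (f y) (f x) := by
      rw [dist_comm (f y) (f x)]; exact dist_triangle _ _ _
    refine ⟨hzS, by linarith, by linarith, ?_⟩
    nlinarith

lemma exists_pow_half_mem_Icc {η : ℝ} (h0 : 0 < η) {d : ℕ} (h : η ≤ (1 / 2) ^ d) :
    ∃ i, d ≤ i ∧ η ≤ (1 / 2 : ℝ) ^ i ∧ (1 / 2 : ℝ) ^ i ≤ 2 * η := by
  have h1 : η ≤ 1 := h.trans (pow_le_one₀ (by norm_num) (by norm_num))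
  obtain ⟨i, hi1, hi2⟩ := exists_nat_pow_near_of_lt_one h0 h1 (by norm_num : (0:ℝ) < 1 / 2)
    (by norm_num)
  refine ⟨i, ?_, hi2, ?_⟩
  · by_contra hlt
    push Not at hlt
    have : (1 / 2 : ℝ) ^ d ≤ (1 / 2) ^ (i + 1) :=
      pow_le_pow_of_le_one (by norm_num) (by norm_num) hlt
    linarith
  · rw [pow_succ] at hi1; linarith

lemma measure_le_of_sparse_flatCone {X : Type*} [MetricSpace X] [MeasurableSpace X] {m : ℕ}
    (κ : Measure X) (f : X → Fin m → ℝ) (S : Set X) (s : ℝ) (l : ℝ≥0∞) (d : ℕ)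
    (O : Set (Fin m → ℝ)) (hs0 : 0 < s) (hs1 : s ≤ 1)
    (hdiam : ∀ x ∈ S, ∀ y ∈ S, dist y x ≤ (1 / 2) ^ d / 4)
    (hO : ∀ x ∈ S, closedBall (f x) 1 ⊆ O)
    (hcone : ∀ x ∈ S, ∀ i, d ≤ i →
      κ (S ∩ flatCone f x s ((1 / 2) ^ i)) ≤ l * ENNReal.ofReal (((1 / 2) ^ i * s) ^ m))
    (hnull : κ {x ∈ S | ∀ y ∈ S, s / 4 * dist y x ≤ dist (f y) (f x)} = 0) :
    κ S ≤ 2 * 80 ^ m * l * volume O := by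
  set S1 := {x ∈ S | ∀ y ∈ S, s / 4 * dist y x ≤ dist (f y) (f x)} with hS1
  have hex : ∀ x : X, ∃ y, x ∈ S \ S1 → y ∈ S ∧ 0 < dist y x ∧
      dist (f y) (f x) < s / 4 * dist y x ∧
      ∀ z ∈ S, dist (f z) (f x) < s / 4 * dist z x → dist z x ≤ 4 / 3 * dist y x := by
    intro x
    by_cases hx : x ∈ S \ S1
    swap
    · exact ⟨x, fun h => absurd h hx⟩
    obtain ⟨hxS, hx1⟩ := hx
    have : ∃ y ∈ S, dist (f y) (f x) < s / 4 * dist y x := by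
      by_contra hno
      push Not at hno
      exact hx1 ⟨hxS, hno⟩
    obtain ⟨y0, hy0S, hy0⟩ := this
    set D : Set ℝ := (fun y => dist y x) '' {y ∈ S | dist (f y) (f x) < s / 4 * dist y x}
    have hDne : D.Nonempty := ⟨_, y0, ⟨hy0S, hy0⟩, rfl⟩
    have hDb : BddAbove D := ⟨(1 / 2) ^ d / 4, by
      rintro _ ⟨y, ⟨hyS, -⟩, rfl⟩; exact hdiam x hxS y hyS⟩
    have hy0pos : 0 < dist y0 x := by
      rcases (dist_nonneg (x := y0) (y := x)).eq_or_lt with h | h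
      · rw [← h, mul_zero] at hy0
        exact absurd hy0 (not_lt.2 dist_nonneg)
      · exact h
    have hpos : 0 < sSup D := hy0pos.trans_le (le_csSup hDb ⟨y0, ⟨hy0S, hy0⟩, rfl⟩)
    obtain ⟨_, ⟨y, ⟨hyS, hy⟩, rfl⟩, hlt⟩ :=
      exists_lt_of_lt_csSup hDne (show 3 / 4 * sSup D < sSup D by linarith)
    dsimp only at hlt
    refine ⟨y, fun _ => ⟨hyS, by linarith, hy, fun z hzS hz => ?_⟩⟩
    have := le_csSup hDb ⟨z, ⟨hzS, hz⟩, rfl⟩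
    dsimp only at this
    linarith
  choose g hg using hex
  have hS : κ S ≤ κ (S \ S1) := by
    calc κ S ≤ κ (S1 ∪ (S \ S1)) := measure_mono (by intro x hx; by_cases h : x ∈ S1 <;> simp [h, hx])
      _ ≤ κ S1 + κ (S \ S1) := measure_union_le _ _
      _ = κ (S \ S1) := by rw [hnull, zero_add]
  refine hS.trans ?_
  have hsmall : ∀ x ∈ S \ S1, dist (g x) x ≤ 1 / 4 := fun x hx =>
    (hdiam x hx.1 _ (hg x hx).1).trans (by
      have : (1 / 2 : ℝ) ^ d ≤ 1 := pow_le_one₀ (by norm_num) (by norm_num)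
      linarith)
  have hrad : ∀ x ∈ S \ S1, s * dist (g x) x / 40 ≤ 1 := fun x hx => by
    have := mul_le_mul hs1 (hsmall x hx) dist_nonneg zero_le_one
    linarith
  have hradpos : ∀ x ∈ S \ S1, 0 < s * dist (g x) x / 40 := fun x hx => by
    have := mul_pos hs0 (hg x hx).2.1
    linarith
  apply measure_le_of_vitali_packing κ f (S \ S1) O (S \ S1) f
    (fun x => s * dist (g x) x / 40) 1 (2 * 80 ^ m * l) hradpos hrad
  · exact fun x hx => (closedBall_subset_closedBall (hrad x hx)).trans (hO x hx.1)
  · exact fun x hx => mem_iUnion₂.2 ⟨x, hx, mem_closedBall_self (hradpos x hx).le⟩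
  · intro x hx
    obtain ⟨hyS, hypos, hy, hmax⟩ := hg x hx
    obtain ⟨i, hid, hi1, hi2⟩ := exists_pow_half_mem_Icc (η := 2 * dist (g x) x) (d := d)
      (by linarith) (by have := hdiam x hx.1 _ hyS; linarith [dist_nonneg (x := g x) (y := x)])
    have hsub := preimage_closedBall_subset_flatCone_union f S hs0 hypos hy hmax hi1
    have hb : ENNReal.ofReal (((1 / 2) ^ i * s) ^ m) ≤
        80 ^ m * ENNReal.ofReal ((2 * (s * dist (g x) x / 40)) ^ m) := by
      have h80 : (80 : ℝ≥0∞) ^ m = ENNReal.ofReal (80 ^ m) := by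
        rw [ENNReal.ofReal_pow (by norm_num)]; norm_num
      rw [h80, ← ENNReal.ofReal_mul (by positivity), ← mul_pow]
      apply ENNReal.ofReal_le_ofReal
      apply pow_le_pow_left₀ (by positivity)
      nlinarith
    calc κ ((S \ S1) ∩ f ⁻¹' closedBall (f x) (5 * (s * dist (g x) x / 40)))
        ≤ κ ((S ∩ flatCone f x s ((1 / 2) ^ i)) ∪ (S ∩ flatCone f (g x) s ((1 / 2) ^ i))) := by
          apply measure_mono
          refine Subset.trans ?_ hsub
          rintro z ⟨hz, hz2⟩
          refine ⟨hz.1, ?_⟩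
          convert hz2 using 3
          ring
      _ ≤ κ (S ∩ flatCone f x s ((1 / 2) ^ i)) + κ (S ∩ flatCone f (g x) s ((1 / 2) ^ i)) :=
          measure_union_le _ _
      _ ≤ l * ENNReal.ofReal (((1 / 2) ^ i * s) ^ m) + l * ENNReal.ofReal (((1 / 2) ^ i * s) ^ m) :=
          add_le_add (hcone x hx.1 i hid) (hcone _ hyS i hid)
      _ = 2 * l * ENNReal.ofReal (((1 / 2) ^ i * s) ^ m) := by ring
      _ ≤ 2 * l * (80 ^ m * ENNReal.ofReal ((2 * (s * dist (g x) x / 40)) ^ m)) := by gcongr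
      _ = 2 * 80 ^ m * l * ENNReal.ofReal ((2 * (s * dist (g x) x / 40)) ^ m) := by ring

lemma exists_lipschitzWith_range_superset {N m : ℕ}
    (f : (Fin N → ℝ) → Fin m → ℝ) (T : Set (Fin N → ℝ)) {c : ℝ} (hc : 0 < c)
    (hT : ∀ x ∈ T, ∀ y ∈ T, c * dist y x ≤ dist (f y) (f x)) :
    ∃ (g : (Fin m → ℝ) → Fin N → ℝ) (K : NNReal), LipschitzWith K g ∧ T ⊆ range g := by
  have hinj : InjOn f T := by
    intro x hx y hy hxy
    have := hT y hy x hx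
    rw [hxy, dist_self] at this
    exact dist_le_zero.1 (nonpos_of_mul_nonpos_right this hc)
  have hlip : LipschitzOnWith (Real.toNNReal c⁻¹) (Function.invFunOn f T) (f '' T) := by
    refine LipschitzOnWith.of_dist_le_mul ?_
    rintro _ ⟨x, hx, rfl⟩ _ ⟨y, hy, rfl⟩
    rw [hinj.leftInvOn_invFunOn hx, hinj.leftInvOn_invFunOn hy,
      Real.coe_toNNReal _ (inv_nonneg.2 hc.le), ← div_eq_inv_mul, le_div_iff₀ hc, mul_comm]
    exact hT y hy x hx
  obtain ⟨g, hg, hgeq⟩ := hlip.extend_pi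
  exact ⟨g, _, hg, fun x hx => ⟨f x, by
    rw [← hgeq (mem_image_of_mem f hx), hinj.leftInvOn_invFunOn hx]⟩⟩

lemma exists_closedBall_subset_near {m : ℕ} {S O : Set (Fin m → ℝ)} {a b : Fin m → ℝ} {ρ : ℝ}
    (ha : a ∈ S) (hb : b ∉ S) (hab : dist b a < ρ) (hO : IsOpen O)
    (hOsub : ball a (3 * ρ) \ S ⊆ O) :
    ∃ r, 0 < r ∧ r ≤ ρ ∧ closedBall b r ⊆ O ∧ ∃ b' ∈ S, dist b b' ≤ 2 * r := by
  have hρ : 0 < ρ := dist_nonneg.trans_lt hab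
  have hbO : b ∈ O := hOsub ⟨by rw [mem_ball]; linarith, hb⟩
  obtain ⟨r0, hr0, hr0O⟩ := Metric.nhds_basis_closedBall.mem_iff.1 (hO.mem_nhds hbO)
  set r1 := min r0 ρ
  have hr1 : 0 < r1 := lt_min hr0 hρ
  by_cases hnear : ∃ b' ∈ S, dist b b' ≤ 2 * r1
  · exact ⟨r1, hr1, min_le_right _ _,
      (closedBall_subset_closedBall (min_le_left _ _)).trans hr0O, hnear⟩
  push Not at hnear
  set dd := infDist b S
  have hne : S.Nonempty := ⟨a, ha⟩
  have hdd : 2 * r1 ≤ dd := (le_infDist hne).2 fun {y} hy => (hnear y hy).le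
  have hddρ : dd ≤ dist b a := infDist_le_dist_of_mem ha
  refine ⟨3 / 4 * dd, by linarith, by linarith, ?_, ?_⟩
  · intro z hz
    rw [mem_closedBall] at hz
    apply hOsub
    constructor
    · rw [mem_ball]
      have := dist_triangle z b a
      linarith
    · intro hzS
      have := infDist_le_dist_of_mem (x := b) hzS
      rw [dist_comm] at this
      change dd ≤ _ at this
      linarith
  · obtain ⟨b', hb', hlt⟩ := (infDist_lt_iff hne).1 (show infDist b S < 3 / 2 * dd by
      change dd < _; linarith)
    exact ⟨b', hb', by linarith⟩

/-- Uniform bound by the volume of the complement, for measures that vanish on `S` and have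
controlled growth at the points of `S`. -/
lemma measure_ball_le_of_growth {m : ℕ} (ν : Measure (Fin m → ℝ)) {S : Set (Fin m → ℝ)}
    (hνS : ν S = 0) {M : ℝ≥0∞} (hM0 : M ≠ 0) (hMtop : M ≠ ⊤) {k₀ : ℕ}
    (hS : ∀ a ∈ S, ∀ k, k₀ ≤ k → ν (ball a ((1 / 2) ^ k)) ≤ M * ENNReal.ofReal (((1 / 2) ^ k) ^ m))
    {a : Fin m → ℝ} (ha : a ∈ S) {ρ : ℝ} (hρ : 16 * ρ ≤ (1 / 2) ^ k₀) :
    ν (ball a ρ) ≤ M * 8 ^ m * volume (ball a (3 * ρ) \ S) := by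
  have hball : ν (ball a ρ) ≤ ν (ball a ρ \ S) := by
    calc ν (ball a ρ) ≤ ν (S ∪ (ball a ρ \ S)) :=
          measure_mono (by intro x hx; by_cases h : x ∈ S <;> simp [h]; simpa using hx)
      _ ≤ ν S + ν (ball a ρ \ S) := measure_union_le _ _
      _ = _ := by rw [hνS, zero_add]
  refine hball.trans ?_
  rw [(ball a (3 * ρ) \ S).measure_eq_iInf_isOpen volume]
  have h80 : M * 8 ^ m ≠ 0 := mul_ne_zero hM0 (by simp)
  have h8top : M * 8 ^ m ≠ ⊤ := ENNReal.mul_ne_top hMtop (by simp)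
  simp_rw [ENNReal.mul_iInf_of_ne h80 h8top]
  refine le_iInf fun O => le_iInf fun hOsub => le_iInf fun hO => ?_
  have hex : ∀ b : Fin m → ℝ, ∃ r, b ∈ ball a ρ \ S →
      0 < r ∧ r ≤ ρ ∧ closedBall b r ⊆ O ∧ ∃ b' ∈ S, dist b b' ≤ 2 * r := by
    intro b
    by_cases hb : b ∈ ball a ρ \ S
    · obtain ⟨r, hr⟩ := exists_closedBall_subset_near ha hb.2 hb.1 hO hOsub
      exact ⟨r, fun _ => hr⟩
    · exact ⟨0, fun h => absurd h hb⟩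
  choose r hr using hex
  apply measure_le_of_vitali_packing ν id (ball a ρ \ S) O (ball a ρ \ S) id r ρ _
    (fun b hb => (hr b hb).1) (fun b hb => (hr b hb).2.1) (fun b hb => (hr b hb).2.2.1)
  · exact fun b hb => mem_iUnion₂.2 ⟨b, hb, mem_closedBall_self (hr b hb).1.le⟩
  · intro b hb
    obtain ⟨hr0, hrρ, -, b', hb'S, hbb'⟩ := hr b hb
    obtain ⟨k, hk, hk1, hk2⟩ := exists_pow_half_mem_Icc (η := 8 * r b) (d := k₀) (by linarith)
      (by linarith)
    calc ν ((ball a ρ \ S) ∩ id ⁻¹' closedBall (id b) (5 * r b)) ≤ ν (ball b' ((1 / 2) ^ k)) := by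
          apply measure_mono
          rintro z ⟨-, hz⟩
          rw [mem_preimage, id, id, mem_closedBall] at hz
          rw [mem_ball]
          have := dist_triangle z b b'
          linarith
      _ ≤ M * ENNReal.ofReal (((1 / 2) ^ k) ^ m) := hS b' hb'S k hk
      _ ≤ M * (8 ^ m * ENNReal.ofReal ((2 * r b) ^ m)) := by
          gcongr
          have h8 : (8 : ℝ≥0∞) ^ m = ENNReal.ofReal (8 ^ m) := by
            rw [ENNReal.ofReal_pow (by norm_num)]; norm_num
          rw [h8, ← ENNReal.ofReal_mul (by positivity), ← mul_pow]
          apply ENNReal.ofReal_le_ofReal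
          apply pow_le_pow_left₀ (by positivity)
          linarith
      _ = _ := by ring

lemma measurable_measure_ball {m : ℕ} (ν : Measure (Fin m → ℝ)) [IsFiniteMeasure ν] (r : ℝ) :
    Measurable fun a => ν (ball a r) := by
  have : MeasurableSet {p : (Fin m → ℝ) × (Fin m → ℝ) | dist p.2 p.1 < r} :=
    (isOpen_lt (by fun_prop) (by fun_prop)).measurableSet
  exact measurable_measure_prodMk_left this

/-- For a family of measures vanishing on `D`, at almost every point of `D` the uniform upper
`m`-density is either `0` or `∞`. -/
lemma ae_uniform_density_zero_of_finite {m : ℕ} (ν : ℕ → Measure (Fin m → ℝ))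
    [∀ i, IsFiniteMeasure (ν i)] {D : Set (Fin m → ℝ)} (hD : MeasurableSet D)
    (hνD : ∀ i, ν i D = 0) :
    ∀ᵐ a : Fin m → ℝ, a ∈ D →
      (∃ M k₀ : ℕ, ∀ k, k₀ ≤ k → ∀ i,
        ν i (ball a ((1 / 2) ^ k)) ≤ M * ENNReal.ofReal (((1 / 2) ^ k) ^ m)) →
      ∀ l : ℕ, ∃ k₀ : ℕ, ∀ k, k₀ ≤ k → ∀ i,
        ν i (ball a ((1 / 2) ^ k)) ≤ (l + 1 : ℝ≥0∞)⁻¹ * ENNReal.ofReal (((1 / 2) ^ k) ^ m) := by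
  set S : ℕ → ℕ → Set (Fin m → ℝ) := fun M k₀ => {a | a ∈ D ∧ ∀ k, k₀ ≤ k → ∀ i,
    ν i (ball a ((1 / 2) ^ k)) ≤ (M + 1 : ℝ≥0∞) * ENNReal.ofReal (((1 / 2) ^ k) ^ m)} with hSdef
  have hSmeas : ∀ M k₀, MeasurableSet (S M k₀) := fun M k₀ => by
    have : S M k₀ = D ∩ ⋂ k, ⋂ (_ : k₀ ≤ k), ⋂ i, {a | ν i (ball a ((1 / 2) ^ k)) ≤
        (M + 1 : ℝ≥0∞) * ENNReal.ofReal (((1 / 2) ^ k) ^ m)} := by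
      ext a; simp [hSdef]
    rw [this]
    refine hD.inter (MeasurableSet.iInter fun k => MeasurableSet.iInter fun _ =>
      MeasurableSet.iInter fun i => ?_)
    exact measurableSet_le (measurable_measure_ball _ _) measurable_const
  have hdens : ∀ᵐ a : Fin m → ℝ, ∀ M k₀, Tendsto (fun r => volume ((S M k₀)ᶜ ∩ closedBall a r) /
      volume (closedBall a r)) (𝓝[>] 0) (𝓝 ((S M k₀)ᶜ.indicator 1 a)) := by
    rw [ae_all_iff]; intro M
    rw [ae_all_iff]; intro k₀
    exact Besicovitch.ae_tendsto_measure_inter_div_of_measurableSet volume (hSmeas M k₀).compl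
  filter_upwards [hdens] with a ha haD ⟨M, k₀, hMk⟩ l
  have haS : a ∈ S M k₀ := ⟨haD, fun k hk i => (hMk k hk i).trans (by gcongr; simp)⟩
  specialize ha M k₀
  rw [indicator_of_notMem (by simpa using haS)] at ha
  set ε : ℝ≥0∞ := ((l + 1 : ℝ≥0∞) * ((M + 1 : ℝ≥0∞) * 8 ^ m * 6 ^ m))⁻¹ with hε
  have hQtop : (l + 1 : ℝ≥0∞) * ((M + 1 : ℝ≥0∞) * 8 ^ m * 6 ^ m) ≠ ⊤ := by finiteness
  have hεpos : 0 < ε := ENNReal.inv_pos.2 hQtop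
  obtain ⟨δ, hδ, hδs⟩ := Metric.mem_nhdsWithin_iff.1 (ha.eventually (gt_mem_nhds hεpos))
  obtain ⟨k₁, hk₁⟩ := exists_pow_lt_of_lt_one (show 0 < min (δ / 3) ((1 / 2) ^ k₀ / 16) by positivity)
    (show (1 / 2 : ℝ) < 1 by norm_num)
  refine ⟨k₁, fun k hk i => ?_⟩
  set ρ : ℝ := (1 / 2) ^ k with hρ
  have hρ0 : 0 < ρ := by positivity
  have hρk : ρ < min (δ / 3) ((1 / 2) ^ k₀ / 16) :=
    (pow_le_pow_of_le_one (by norm_num) (by norm_num) hk).trans_lt hk₁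
  have hρ1 := hρk.trans_le (min_le_left _ _)
  have hρ2 := hρk.trans_le (min_le_right _ _)
  have hvol : volume (ball a (3 * ρ) \ S M k₀) ≤ ε * (6 ^ m * ENNReal.ofReal (ρ ^ m)) := by
    have h1 : volume ((S M k₀)ᶜ ∩ closedBall a (3 * ρ)) / volume (closedBall a (3 * ρ)) < ε := by
      apply hδs
      refine ⟨?_, show 0 < 3 * ρ by positivity⟩
      rw [mem_ball, Real.dist_eq, sub_zero, abs_of_pos (by positivity)]
      linarith
    rw [Real.volume_pi_closedBall _ (by positivity), Fintype.card_fin,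
      ENNReal.div_lt_iff (Or.inl (by positivity)) (Or.inl ENNReal.ofReal_ne_top)] at h1
    calc volume (ball a (3 * ρ) \ S M k₀) ≤ volume ((S M k₀)ᶜ ∩ closedBall a (3 * ρ)) :=
          measure_mono fun x hx => ⟨hx.2, ball_subset_closedBall hx.1⟩
      _ ≤ ε * ENNReal.ofReal ((2 * (3 * ρ)) ^ m) := h1.le
      _ = ε * (6 ^ m * ENNReal.ofReal (ρ ^ m)) := by
          rw [← mul_assoc 2 3 ρ, mul_pow, ENNReal.ofReal_mul (by positivity),
            ENNReal.ofReal_pow (by norm_num)]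
          norm_num
  calc ν i (ball a ρ) ≤ (M + 1) * 8 ^ m * volume (ball a (3 * ρ) \ S M k₀) :=
        measure_ball_le_of_growth (ν i) (measure_mono_null (fun x hx => hx.1) (hνD i))
          (by simp) (by finiteness) (fun a ha k hk => ha.2 k hk i) haS (by linarith)
    _ ≤ (M + 1) * 8 ^ m * (ε * (6 ^ m * ENNReal.ofReal (ρ ^ m))) := by gcongr
    _ = ((M + 1) * 8 ^ m * 6 ^ m * ε) * ENNReal.ofReal (ρ ^ m) := by ring
    _ = (l + 1 : ℝ≥0∞)⁻¹ * ENNReal.ofReal (ρ ^ m) := by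
        congr 1
        rw [hε, ENNReal.mul_inv (Or.inl (by simp)) (Or.inl (by finiteness)), mul_left_comm,
          ENNReal.mul_inv_cancel (by simp) (by finiteness), mul_one]

/-- The index of the cell of side `1 / j` containing `x`. -/
def cellIndex {N : ℕ} (j : ℕ) (x : Fin N → ℝ) : Fin N → ℤ := fun i => ⌊(j : ℝ) * x i⌋

lemma measurable_cellIndex {N : ℕ} (j : ℕ) : Measurable (cellIndex (N := N) j) := by
  unfold cellIndex
  exact measurable_pi_lambda _ fun i => ((measurable_pi_apply i).const_mul _).floor

lemma eventually_cellIndex_ne {N : ℕ} {x y : Fin N → ℝ} (h : x ≠ y) :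
    ∀ᶠ j : ℕ in atTop, cellIndex j x ≠ cellIndex j y := by
  obtain ⟨i, hi⟩ := Function.ne_iff.1 h
  have hpos : 0 < |x i - y i| := abs_pos.2 (sub_ne_zero.2 hi)
  obtain ⟨j₀, hj₀⟩ := exists_nat_gt (1 / |x i - y i|)
  filter_upwards [eventually_ge_atTop j₀] with j hj heq
  have h1 := Int.abs_sub_lt_one_of_floor_eq_floor (congrFun heq i)
  rw [← mul_sub, abs_mul, Nat.abs_cast] at h1
  have h2 : 1 / |x i - y i| < j := hj₀.trans_le (by exact_mod_cast hj)
  rw [div_lt_iff₀ hpos] at h2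
  linarith

lemma eventually_injOn_cellIndex {N : ℕ} (t : Finset (Fin N → ℝ)) :
    ∀ᶠ j : ℕ in atTop, InjOn (cellIndex (N := N) j) t := by
  have : ∀ᶠ j : ℕ in atTop, ∀ x ∈ t, ∀ y ∈ t, x ≠ y → cellIndex j x ≠ cellIndex j y := by
    rw [Filter.eventually_all_finset]; intro x _
    rw [Filter.eventually_all_finset]; intro y _
    by_cases h : x = y
    · simp [h]
    · filter_upwards [eventually_cellIndex_ne h] with j hj _ using hj
  filter_upwards [this] with j hj x hx y hy hxy
  by_contra hne
  exact hj x hx y hy hne hxy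

lemma volume_image_le_hausdorffMeasure {X : Type*} [MetricSpace X] [MeasurableSpace X]
    [BorelSpace X] {m : ℕ} {f : X → Fin m → ℝ} {K : NNReal} {s : Set X}
    (hf : LipschitzOnWith K f s) :
    volume (f '' s) ≤ (K : ℝ≥0∞) ^ m * μH[m] s := by
  have h := hf.hausdorffMeasure_image_le (d := (m : ℝ)) (by positivity)
  have h2 : (μH[(m : ℝ)] : Measure (Fin m → ℝ)) = volume := by
    rw [← hausdorffMeasure_pi_real, Fintype.card_fin]
  rwa [h2, ENNReal.rpow_natCast] at h

/-- The image of the points that accumulate on their own fibre is null. -/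
lemma volume_image_fibre_accumulation {N m : ℕ} {f : (Fin N → ℝ) → Fin m → ℝ} {K : NNReal}
    (hf : LipschitzWith K f) {A : Set (Fin N → ℝ)} (hA : MeasurableSet A) (hfin : μH[m] A ≠ ⊤) :
    volume (f '' {x ∈ A | ∀ δ : ℝ, 0 < δ → ∃ y ∈ A, 0 < dist y x ∧ dist y x < δ ∧ f y = f x})
      = 0 := by
  set T : ℕ → (Fin N → ℤ) → Set (Fin m → ℝ) := fun j q =>
    toMeasurable volume (f '' (A ∩ cellIndex j ⁻¹' {q})) with hT
  set F : ℕ → (Fin m → ℝ) → ℝ≥0∞ := fun j p => ∑' q, (T j q).indicator 1 p with hF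
  have hTm : ∀ j q, MeasurableSet (T j q) := fun j q => measurableSet_toMeasurable _ _
  have hFm : ∀ j, Measurable (F j) := fun j =>
    Measurable.tsum fun q => measurable_one.indicator (hTm j q)
  have hlint : ∀ j, ∫⁻ p, F j p ≤ (K : ℝ≥0∞) ^ m * μH[m] A := fun j => by
    have hAq : ∑' q, μH[m] (A ∩ cellIndex j ⁻¹' {q}) = μH[m] A := by
      rw [← measure_iUnion]
      · rw [← inter_iUnion, ← preimage_iUnion, iUnion_singleton_eq_range]
        simp
      · intro q q' hqq'
        refine Disjoint.mono inter_subset_right inter_subset_right ?_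
        exact Disjoint.preimage _ (by simpa using hqq')
      · exact fun q => hA.inter (measurable_cellIndex j (measurableSet_singleton q))
    rw [lintegral_tsum fun q => (measurable_one.indicator (hTm j q)).aemeasurable]
    calc ∑' q, ∫⁻ p, (T j q).indicator 1 p = ∑' q, volume (f '' (A ∩ cellIndex j ⁻¹' {q})) := by
          congr 1; ext q
          rw [lintegral_indicator_one (hTm j q), hT, measure_toMeasurable]
      _ ≤ ∑' q, (K : ℝ≥0∞) ^ m * μH[m] (A ∩ cellIndex j ⁻¹' {q}) :=
          ENNReal.tsum_le_tsum fun q => volume_image_le_hausdorffMeasure hf.lipschitzOnWith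
      _ = _ := by rw [ENNReal.tsum_mul_left, hAq]
  have hlim : ∫⁻ p, liminf (fun j => F j p) atTop ≠ ⊤ := by
    have hb : (K : ℝ≥0∞) ^ m * μH[m] A < ⊤ := ENNReal.mul_lt_top (by finiteness) hfin.lt_top
    exact (((lintegral_liminf_le hFm).trans
      (liminf_le_of_frequently_le' (Frequently.of_forall hlint))).trans_lt hb).ne
  have hae := ae_lt_top (Measurable.liminf hFm) hlim
  suffices ∀ᵐ p : Fin m → ℝ, p ∉ f '' {x ∈ A | ∀ δ : ℝ, 0 < δ →
      ∃ y ∈ A, 0 < dist y x ∧ dist y x < δ ∧ f y = f x} by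
    exact measure_eq_zero_iff_ae_notMem.2 this
  filter_upwards [hae] with p hp
  rintro ⟨x, ⟨hxA, hx⟩, rfl⟩
  have hinf : (A ∩ f ⁻¹' {f x}).Infinite := by
    intro hfinite
    have hcl : IsClosed ((A ∩ f ⁻¹' {f x}) \ {x}) := (hfinite.subset sdiff_subset).isClosed
    obtain ⟨δ, hδ, hδs⟩ := Metric.isOpen_iff.1 hcl.isOpen_compl x (by simp)
    obtain ⟨y, hyA, hy0, hyδ, hyf⟩ := hx δ hδ
    exact hδs hyδ ⟨⟨hyA, hyf⟩, by simpa using dist_pos.1 hy0⟩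
  refine absurd hp (not_lt.2 (top_le_iff.2 ?_))
  rw [← top_le_iff]
  refine ENNReal.le_of_forall_nnreal_lt fun c _ => ?_
  obtain ⟨M, hM⟩ := exists_nat_ge c
  obtain ⟨t, htsub, htcard⟩ := hinf.exists_subset_card_eq M
  refine le_liminf_of_le (by isBoundedDefault) ?_
  filter_upwards [eventually_injOn_cellIndex t] with j hj
  calc (c : ℝ≥0∞) ≤ M := by exact_mod_cast hM
    _ = ∑ q ∈ t.image (cellIndex j), 1 := by
        rw [Finset.sum_const, Finset.card_image_of_injOn hj, htcard]; simp
    _ ≤ ∑ q ∈ t.image (cellIndex j), (T j q).indicator 1 (f x) := by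
        refine Finset.sum_le_sum fun q hq => ?_
        obtain ⟨y, hy, rfl⟩ := Finset.mem_image.1 hq
        have hyA := htsub hy
        rw [indicator_of_mem]
        · rfl
        · exact subset_toMeasurable _ _ ⟨y, ⟨hyA.1, rfl⟩, hyA.2⟩
    _ ≤ F j (f x) := ENNReal.sum_le_tsum _

/-- The linear map `ℝᴺ → ℝᵐ` with prescribed columns. -/
def colMap {N m : ℕ} (L : Fin N → Fin m → ℝ) (x : Fin N → ℝ) : Fin m → ℝ := ∑ j, x j • L j

lemma continuous_colMap_uncurry {N m : ℕ} :
    Continuous fun p : (Fin N → Fin m → ℝ) × (Fin N → ℝ) => colMap p.1 p.2 := by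
  unfold colMap
  fun_prop

@[fun_prop]
lemma Continuous.colMap {T : Type*} [TopologicalSpace T] {N m : ℕ} {L : T → Fin N → Fin m → ℝ}
    {x : T → Fin N → ℝ} (hL : Continuous L) (hx : Continuous x) :
    Continuous fun t => colMap (L t) (x t) :=
  continuous_colMap_uncurry.comp (hL.prodMk hx)

lemma colMap_sub {N m : ℕ} (L : Fin N → Fin m → ℝ) (x y : Fin N → ℝ) :
    colMap L (x - y) = colMap L x - colMap L y := by
  simp [colMap, sub_smul]

lemma colMap_add_single {N m : ℕ} (L : Fin N → Fin m → ℝ) (j : Fin N) (a : Fin m → ℝ)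
    (x : Fin N → ℝ) : colMap (L + Pi.single j a) x = colMap L x + x j • a := by
  simp only [colMap, Pi.add_apply, smul_add, Finset.sum_add_distrib]
  congr 1
  rw [Finset.sum_eq_single j] <;> simp +contextual

lemma exists_lipschitzWith_colMap {N m : ℕ} (L : Fin N → Fin m → ℝ) :
    ∃ K : NNReal, LipschitzWith K (colMap L) := by
  refine ⟨∑ j, ‖L j‖₊, LipschitzWith.of_dist_le_mul fun x y => ?_⟩
  rw [dist_eq_norm, ← colMap_sub, dist_eq_norm, NNReal.coe_sum, Finset.sum_mul]
  refine (norm_sum_le _ _).trans (Finset.sum_le_sum fun j _ => ?_)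
  rw [norm_smul, mul_comm, coe_nnnorm]
  gcongr
  exact norm_le_pi_norm (x - y) j

/-- Punctured ball around `x` intersected with the sector where the `j`-th coordinate dominates. -/
def sector {N : ℕ} (j : Fin N) (x : Fin N → ℝ) (r : ℝ) : Set (Fin N → ℝ) :=
  {y | 0 < dist y x ∧ dist y x ≤ r ∧ dist y x = |y j - x j|}

/-- The part of a flat cone of `colMap L` lying in a sector. -/
def sectorCone {N m : ℕ} (L : Fin N → Fin m → ℝ) (j : Fin N) (x : Fin N → ℝ) (s r : ℝ) :
    Set (Fin N → ℝ) :=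
  sector j x r ∩ {y | dist (colMap L y) (colMap L x) < s * dist y x}

lemma flatCone_colMap_subset {N m : ℕ} (L : Fin N → Fin m → ℝ) (x : Fin N → ℝ) (s r : ℝ) :
    flatCone (colMap L) x s r ⊆ ⋃ j, sectorCone L j x s r := by
  rintro y ⟨h0, hr, hs⟩
  have : ∃ j, dist y x = |y j - x j| := by
    by_contra hno
    push Not at hno
    refine lt_irrefl (dist y x) ((dist_pi_lt_iff h0).2 fun j => ?_)
    exact lt_of_le_of_ne (dist_le_pi_dist y x j) (hno j).symm
  obtain ⟨j, hj⟩ := this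
  exact mem_iUnion.2 ⟨j, ⟨h0, hr, hj⟩, hs⟩

lemma measurable_measure_sectorCone {N m : ℕ} (μ : Measure (Fin N → ℝ)) [IsFiniteMeasure μ]
    (j : Fin N) (s r : ℝ) :
    Measurable fun p : (Fin N → ℝ) × (Fin N → Fin m → ℝ) => μ (sectorCone p.2 j p.1 s r) := by
  have : MeasurableSet {q : ((Fin N → ℝ) × (Fin N → Fin m → ℝ)) × (Fin N → ℝ) |
      (0 < dist q.2 q.1.1 ∧ dist q.2 q.1.1 ≤ r ∧ dist q.2 q.1.1 = |q.2 j - q.1.1 j|) ∧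
      dist (colMap q.1.2 q.2) (colMap q.1.2 q.1.1) < s * dist q.2 q.1.1} := by
    have h1 : IsOpen {q : ((Fin N → ℝ) × (Fin N → Fin m → ℝ)) × (Fin N → ℝ) |
        0 < dist q.2 q.1.1} := isOpen_lt (by fun_prop) (by fun_prop)
    have h2 : IsClosed {q : ((Fin N → ℝ) × (Fin N → Fin m → ℝ)) × (Fin N → ℝ) |
        dist q.2 q.1.1 ≤ r} := isClosed_le (by fun_prop) (by fun_prop)
    have h3 : IsClosed {q : ((Fin N → ℝ) × (Fin N → Fin m → ℝ)) × (Fin N → ℝ) |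
        dist q.2 q.1.1 = |q.2 j - q.1.1 j|} := isClosed_eq (by fun_prop) (by fun_prop)
    have h4 : IsOpen {q : ((Fin N → ℝ) × (Fin N → Fin m → ℝ)) × (Fin N → ℝ) |
        dist (colMap q.1.2 q.2) (colMap q.1.2 q.1.1) < s * dist q.2 q.1.1} :=
      isOpen_lt (by fun_prop) (by fun_prop)
    exact (h1.measurableSet.inter (h2.measurableSet.inter h3.measurableSet)).inter h4.measurableSet
  exact measurable_measure_prodMk_left this

/-- The fibre of `colMap L` through `x` meets `A` in the sector of radius `2⁻ᵈ`. -/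
def FibreMeets {N m : ℕ} (A : Set (Fin N → ℝ)) (j : Fin N) (d : ℕ)
    (p : (Fin N → ℝ) × (Fin N → Fin m → ℝ)) : Prop :=
  ∃ y ∈ A, y ∈ sector j p.1 ((1 / 2) ^ d) ∧ colMap p.2 y = colMap p.2 p.1

def ConeBound {N m : ℕ} (μ : Measure (Fin N → ℝ)) (j : Fin N) (d : ℕ) (c : ℝ≥0∞) (k₀ : ℕ)
    (p : (Fin N → ℝ) × (Fin N → Fin m → ℝ)) : Prop :=
  ∀ k, k₀ ≤ k → ∀ i, μ (sectorCone p.2 j p.1 ((1 / 2) ^ k) ((1 / 2) ^ (d + i))) ≤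
    c * ENNReal.ofReal (((1 / 2) ^ (d + i) * (1 / 2) ^ k) ^ m)

lemma measurableSet_coneBound {N m : ℕ} (μ : Measure (Fin N → ℝ)) [IsFiniteMeasure μ] (j : Fin N)
    (d : ℕ) (c : ℝ≥0∞) (k₀ : ℕ) :
    MeasurableSet {p : (Fin N → ℝ) × (Fin N → Fin m → ℝ) | ConeBound μ j d c k₀ p} := by
  have : {p : (Fin N → ℝ) × (Fin N → Fin m → ℝ) | ConeBound μ j d c k₀ p} =
      ⋂ k, ⋂ (_ : k₀ ≤ k), ⋂ i, {p | μ (sectorCone p.2 j p.1 ((1 / 2) ^ k) ((1 / 2) ^ (d + i))) ≤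
    c * ENNReal.ofReal (((1 / 2) ^ (d + i) * (1 / 2) ^ k) ^ m)} := by
    ext p; simp [ConeBound]
  rw [this]
  exact MeasurableSet.iInter fun k => MeasurableSet.iInter fun _ => MeasurableSet.iInter fun i =>
    measurableSet_le (measurable_measure_sectorCone μ j _ _) measurable_const

lemma isClosed_setOf_exists_mem_compact {P Q : Type*} [TopologicalSpace P] [TopologicalSpace Q]
    {A : Set Q} (hA : IsCompact A) {C : Set (P × Q)} (hC : IsClosed C) :
    IsClosed {p | ∃ y ∈ A, (p, y) ∈ C} := by
  have : CompactSpace A := isCompact_iff_compactSpace.1 hA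
  have h := isClosedMap_fst_of_compactSpace (X := P) (Y := A)
    {q : P × A | (q.1, (q.2 : Q)) ∈ C} (hC.preimage (by fun_prop))
  convert h using 1
  ext p
  simp

lemma measurableSet_fibreMeets {N m : ℕ} {A : Set (Fin N → ℝ)} (hA : IsCompact A) (j : Fin N)
    (d : ℕ) :
    MeasurableSet {p : (Fin N → ℝ) × (Fin N → Fin m → ℝ) | FibreMeets A j d p} := by
  have : {p : (Fin N → ℝ) × (Fin N → Fin m → ℝ) | FibreMeets A j d p} =
      ⋃ q : ℕ, {p | ∃ y ∈ A, (p, y) ∈ {w : ((Fin N → ℝ) × (Fin N → Fin m → ℝ)) × (Fin N → ℝ) |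
        1 / (q + 1 : ℝ) ≤ dist w.2 w.1.1 ∧ dist w.2 w.1.1 ≤ (1 / 2) ^ d ∧
        dist w.2 w.1.1 = |w.2 j - w.1.1 j| ∧ colMap w.1.2 w.2 = colMap w.1.2 w.1.1}} := by
    ext p
    simp only [FibreMeets, sector, mem_ofPred_eq, mem_iUnion]
    constructor
    · rintro ⟨y, hyA, ⟨h0, h1, h2⟩, h3⟩
      obtain ⟨q, hq⟩ := exists_nat_one_div_lt h0
      exact ⟨q, y, hyA, hq.le, h1, h2, h3⟩
    · rintro ⟨q, y, hyA, h0, h1, h2, h3⟩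
      exact ⟨y, hyA, ⟨lt_of_lt_of_le (by positivity) h0, h1, h2⟩, h3⟩
  rw [this]
  refine MeasurableSet.iUnion fun q => (isClosed_setOf_exists_mem_compact hA ?_).measurableSet
  have h1 : IsClosed {w : ((Fin N → ℝ) × (Fin N → Fin m → ℝ)) × (Fin N → ℝ) |
      1 / (q + 1 : ℝ) ≤ dist w.2 w.1.1} := isClosed_le (by fun_prop) (by fun_prop)
  have h2 : IsClosed {w : ((Fin N → ℝ) × (Fin N → Fin m → ℝ)) × (Fin N → ℝ) |
      dist w.2 w.1.1 ≤ (1 / 2) ^ d} := isClosed_le (by fun_prop) (by fun_prop)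
  have h3 : IsClosed {w : ((Fin N → ℝ) × (Fin N → Fin m → ℝ)) × (Fin N → ℝ) |
      dist w.2 w.1.1 = |w.2 j - w.1.1 j|} := isClosed_eq (by fun_prop) (by fun_prop)
  have h4 : IsClosed {w : ((Fin N → ℝ) × (Fin N → Fin m → ℝ)) × (Fin N → ℝ) |
      colMap w.1.2 w.2 = colMap w.1.2 w.1.1} := isClosed_eq (by fun_prop) (by fun_prop)
  exact h1.inter (h2.inter (h3.inter h4))

/-- The value of the `j`-th column for which `x` and `y` lie on the same fibre. -/
def criticalColumn {N m : ℕ} (L : Fin N → Fin m → ℝ) (j : Fin N) (x y : Fin N → ℝ) : Fin m → ℝ :=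
  -(y j - x j)⁻¹ • (colMap L y - colMap L x)

lemma colMap_add_single_sub {N m : ℕ} (L : Fin N → Fin m → ℝ) (j : Fin N) (a : Fin m → ℝ)
    {x y : Fin N → ℝ} (h : y j - x j ≠ 0) :
    colMap (L + Pi.single j a) y - colMap (L + Pi.single j a) x =
      (y j - x j) • (a - criticalColumn L j x y) := by
  rw [colMap_add_single, colMap_add_single, criticalColumn, smul_sub, smul_smul, mul_neg,
    mul_inv_cancel₀ h, sub_smul]
  module

lemma sectorCone_add_single {N m : ℕ} (L : Fin N → Fin m → ℝ) (j : Fin N) (a : Fin m → ℝ)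
    (x : Fin N → ℝ) (s r : ℝ) :
    sectorCone (L + Pi.single j a) j x s r =
      criticalColumn L j x ⁻¹' ball a s ∩ sector j x r := by
  ext y
  rw [sectorCone, inter_comm]
  refine and_congr_left fun ⟨h0, _, h2⟩ => ?_
  have hne : y j - x j ≠ 0 := by rw [h2] at h0; exact abs_pos.1 h0
  rw [mem_ofPred_eq, mem_preimage, mem_ball, dist_eq_norm (colMap _ _),
    colMap_add_single_sub L j a hne, norm_smul, Real.norm_eq_abs, ← h2, mul_comm s,
    mul_lt_mul_iff_right₀ h0, dist_comm, dist_eq_norm]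

lemma measurable_criticalColumn {N m : ℕ} (L : Fin N → Fin m → ℝ) (j : Fin N) (x : Fin N → ℝ) :
    Measurable (criticalColumn L j x) := by
  unfold criticalColumn
  have h : Measurable fun y : Fin N → ℝ => -(y j - x j)⁻¹ := by fun_prop
  refine h.smul ?_
  exact (by fun_prop : Continuous fun y => colMap L y - colMap L x).measurable

lemma ae_column_dichotomy {N m : ℕ} {A : Set (Fin N → ℝ)} (hA : IsCompact A)
    (μ : Measure (Fin N → ℝ)) [IsFiniteMeasure μ] (hμ : μ Aᶜ = 0) (x : Fin N → ℝ)
    (L : Fin N → Fin m → ℝ) (j : Fin N) (d : ℕ) :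
    ∀ᵐ a : Fin m → ℝ, ¬ FibreMeets A j d (x, L + Pi.single j a) →
      (∃ M k₀ : ℕ, ConeBound μ j d M k₀ (x, L + Pi.single j a)) →
      ∀ l : ℕ, ∃ k₀ : ℕ, ConeBound μ j d (l + 1 : ℝ≥0∞)⁻¹ k₀ (x, L + Pi.single j a) := by
  set R : ℕ → ℝ≥0∞ := fun i => ENNReal.ofReal (((1 / 2) ^ (d + i)) ^ m) with hR
  have hR0 : ∀ i, R i ≠ 0 := fun i => (ENNReal.ofReal_pos.2 (by positivity)).ne'
  have hRtop : ∀ i, R i ≠ ⊤ := fun i => ENNReal.ofReal_ne_top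
  set ν : ℕ → Measure (Fin m → ℝ) := fun i =>
    (R i)⁻¹ • (μ.restrict (sector j x ((1 / 2) ^ (d + i)))).map (criticalColumn L j x) with hν
  have hνfin : ∀ i, IsFiniteMeasure (ν i) := fun i =>
    Measure.smul_finite _ (ENNReal.inv_ne_top.2 (hR0 i))
  have hνapp : ∀ i (B : Set (Fin m → ℝ)), MeasurableSet B → ν i B =
      (R i)⁻¹ * μ (criticalColumn L j x ⁻¹' B ∩ sector j x ((1 / 2) ^ (d + i))) := fun i B hB => by
    rw [hν, Measure.smul_apply, Measure.map_apply (measurable_criticalColumn L j x) hB,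
      Measure.restrict_apply (measurable_criticalColumn L j x hB), smul_eq_mul]
  set D : Set (Fin m → ℝ) := {a | ¬ FibreMeets A j d (x, L + Pi.single j a)} with hDdef
  have hD : MeasurableSet D := by
    refine (MeasurableSet.preimage (measurableSet_fibreMeets hA j d) ?_).compl
    exact (continuous_const.prodMk (continuous_const.add (continuous_single j))).measurable
  have hνD : ∀ i, ν i D = 0 := fun i => by
    rw [hνapp i D hD, measure_mono_null _ hμ, mul_zero]
    rintro y ⟨hyD, hy⟩ hyA
    refine hyD ⟨y, hyA, ⟨hy.1, hy.2.1.trans ?_, hy.2.2⟩, ?_⟩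
    · exact pow_le_pow_of_le_one (by norm_num) (by norm_num) (by omega)
    · have hne : y j - x j ≠ 0 := by have := hy.1; rw [hy.2.2] at this; exact abs_pos.1 this
      rw [← sub_eq_zero]
      simp only
      rw [colMap_add_single_sub L j _ hne, sub_self, smul_zero]
  have hkey : ∀ (a : Fin m → ℝ) (c : ℝ≥0∞) (k i : ℕ),
      ν i (ball a ((1 / 2) ^ k)) ≤ c * ENNReal.ofReal (((1 / 2) ^ k) ^ m) ↔
      μ (sectorCone (L + Pi.single j a) j x ((1 / 2) ^ k) ((1 / 2) ^ (d + i))) ≤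
        c * ENNReal.ofReal (((1 / 2) ^ (d + i) * (1 / 2) ^ k) ^ m) := fun a c k i => by
    rw [hνapp i _ measurableSet_ball, sectorCone_add_single,
      ENNReal.inv_mul_le_iff (hR0 i) (hRtop i), mul_pow, ENNReal.ofReal_mul (by positivity),
      mul_left_comm]
  filter_upwards [ae_uniform_density_zero_of_finite ν hD hνD] with a ha haD ⟨M, k₀, hM⟩ l
  obtain ⟨k₁, hk₁⟩ := ha haD ⟨M, k₀, fun k hk i => (hkey a M k i).2 (hM k hk i)⟩ l
  exact ⟨k₁, fun k hk i => (hkey a _ k i).1 (hk₁ k hk i)⟩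

lemma ae_ae_cone_dichotomy {N m : ℕ} {A : Set (Fin N → ℝ)} (hA : IsCompact A)
    (μ : Measure (Fin N → ℝ)) [IsFiniteMeasure μ] (hμ : μ Aᶜ = 0) :
    ∀ᵐ L : Fin N → Fin m → ℝ, ∀ᵐ x ∂μ, ∀ (j : Fin N) (d : ℕ), ¬ FibreMeets A j d (x, L) →
      (∃ M k₀ : ℕ, ConeBound μ j d M k₀ (x, L)) →
      ∀ l : ℕ, ∃ k₀ : ℕ, ConeBound μ j d (l + 1 : ℝ≥0∞)⁻¹ k₀ (x, L) := by
  have key : ∀ (j : Fin N) (d : ℕ), ∀ᵐ L : Fin N → Fin m → ℝ, ∀ᵐ x ∂μ,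
      ¬ FibreMeets A j d (x, L) → (∃ M k₀ : ℕ, ConeBound μ j d M k₀ (x, L)) →
      ∀ l : ℕ, ∃ k₀ : ℕ, ConeBound μ j d (l + 1 : ℝ≥0∞)⁻¹ k₀ (x, L) := fun j d => by
    have hmeas : MeasurableSet {p : (Fin N → ℝ) × (Fin N → Fin m → ℝ) |
        ¬ FibreMeets A j d p → (∃ M k₀ : ℕ, ConeBound μ j d M k₀ p) →
        ∀ l : ℕ, ∃ k₀ : ℕ, ConeBound μ j d (l + 1 : ℝ≥0∞)⁻¹ k₀ p} := by
      have h1 := measurableSet_fibreMeets (m := m) hA j d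
      have h2 : MeasurableSet {p : (Fin N → ℝ) × (Fin N → Fin m → ℝ) |
          ∃ M k₀ : ℕ, ConeBound μ j d M k₀ p} := by
        simp only [ofPred_exists]
        exact MeasurableSet.iUnion fun M => MeasurableSet.iUnion fun k =>
          measurableSet_coneBound μ j d M k
      have h3 : MeasurableSet {p : (Fin N → ℝ) × (Fin N → Fin m → ℝ) |
          ∀ l : ℕ, ∃ k₀ : ℕ, ConeBound μ j d (l + 1 : ℝ≥0∞)⁻¹ k₀ p} := by
        simp only [ofPred_exists, ofPred_forall]
        exact MeasurableSet.iInter fun l => MeasurableSet.iUnion fun k =>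
          measurableSet_coneBound μ j d _ k
      exact h1.compl.imp (h2.imp h3)
    rw [← Measure.ae_ae_comm hmeas]
    refine ae_of_all _ fun x => ?_
    exact ae_mem_of_ae_add_linearMap_mem
      (LinearMap.single ℝ (fun _ : Fin N => Fin m → ℝ) j) volume volume
      (measurable_prodMk_left hmeas) fun L => ae_column_dichotomy hA μ hμ x L j d
  filter_upwards [ae_all_iff.2 fun j => ae_all_iff.2 (key j)] with L hL
  exact ae_all_iff.2 fun j => ae_all_iff.2 (hL j)

lemma ConeBound.mono {N m : ℕ} {μ : Measure (Fin N → ℝ)} {j : Fin N} {d : ℕ} {c : ℝ≥0∞}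
    {k₀ k₁ : ℕ} {p : (Fin N → ℝ) × (Fin N → Fin m → ℝ)} (h : ConeBound μ j d c k₀ p)
    (hk : k₀ ≤ k₁) : ConeBound μ j d c k₁ p :=
  fun k hk' => h k (hk.trans hk')

lemma ae_not_vanishing_cone {N m : ℕ} (A : Set (Fin N → ℝ))
    (μ : Measure (Fin N → ℝ))
    (hpu : ∀ g : (Fin m → ℝ) → Fin N → ℝ, (∃ K, LipschitzWith K g) → μ (A ∩ range g) = 0)
    (L : Fin N → Fin m → ℝ) (d : ℕ) :
    μ {x ∈ A | ∀ (j : Fin N) (l : ℕ), ∃ k₀ : ℕ, ConeBound μ j d (l + 1 : ℝ≥0∞)⁻¹ k₀ (x, L)} = 0 := by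
  obtain ⟨K, hK⟩ := exists_lipschitzWith_colMap L
  refine measure_null_of_locally_null _ fun x₀ _ => ?_
  set G := {x ∈ A | ∀ (j : Fin N) (l : ℕ), ∃ k₀ : ℕ, ConeBound μ j d (l + 1 : ℝ≥0∞)⁻¹ k₀ (x, L)}
    with hG
  refine ⟨G ∩ ball x₀ ((1 / 2) ^ d / 8), inter_mem_nhdsWithin _ (ball_mem_nhds _ (by positivity)), ?_⟩
  set u := G ∩ ball x₀ ((1 / 2) ^ d / 8) with hu
  set O := closedBall (colMap L x₀) (K * ((1 / 2) ^ d / 8) + 1) with hO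
  have hbound : ∀ l : ℕ, μ u ≤ 2 * 80 ^ m * (N * (l + 1 : ℝ≥0∞)⁻¹) * volume O := fun l => by
    set S : ℕ → Set (Fin N → ℝ) := fun k₀ => {x ∈ u | ∀ j, ConeBound μ j d (l + 1 : ℝ≥0∞)⁻¹ k₀ (x, L)}
      with hS
    have hmono : Monotone S := fun a b hab x hx => ⟨hx.1, fun j => (hx.2 j).mono hab⟩
    have hsub : u ⊆ ⋃ k, S k := fun x hx => by
      choose k hk using fun j => hx.1.2 j l
      exact mem_iUnion.2 ⟨Finset.univ.sup k, hx, fun j =>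
        (hk j).mono (Finset.le_sup (Finset.mem_univ j))⟩
    refine (measure_mono hsub).trans ?_
    rw [hmono.measure_iUnion]
    refine iSup_le fun k => ?_
    refine measure_le_of_sparse_flatCone μ (colMap L) (S k) ((1 / 2) ^ k) _ d O (by positivity)
      (pow_le_one₀ (by norm_num) (by norm_num)) ?_ ?_ ?_ ?_
    · intro x hx y hy
      have h1 := mem_ball.1 hx.1.2
      have h2 := mem_ball.1 hy.1.2
      have := dist_triangle_right y x x₀
      linarith
    · intro x hx
      refine closedBall_subset_closedBall' ?_
      have h1 := (hK.dist_le_mul x x₀).trans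
        (mul_le_mul_of_nonneg_left (mem_ball.1 hx.1.2).le K.2)
      linarith
    · intro x hx i hi
      obtain ⟨i, rfl⟩ := Nat.exists_eq_add_of_le hi
      refine (measure_mono (inter_subset_right.trans (flatCone_colMap_subset L x _ _))).trans ?_
      refine (measure_iUnion_le _).trans ?_
      rw [tsum_fintype]
      refine (Finset.sum_le_sum fun j _ => hx.2 j k le_rfl i).trans ?_
      rw [Finset.sum_const, Finset.card_univ, Fintype.card_fin, nsmul_eq_mul, mul_assoc]
    · obtain ⟨g, K', hg, hsub⟩ := exists_lipschitzWith_range_superset (colMap L)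
        {x ∈ S k | ∀ y ∈ S k, (1 / 2) ^ k / 4 * dist y x ≤ dist (colMap L y) (colMap L x)}
        (c := (1 / 2) ^ k / 4) (by positivity) fun x hx y hy => hx.2 y hy.1
      refine measure_mono_null ?_ (hpu g ⟨K', hg⟩)
      exact fun x hx => ⟨hx.1.1.1.1, hsub hx⟩
  have hlim : Tendsto (fun l : ℕ => 2 * 80 ^ m * (N * (l + 1 : ℝ≥0∞)⁻¹) * volume O) atTop (𝓝 0) := by
    have h1 : Tendsto (fun l : ℕ => (l + 1 : ℝ≥0∞)⁻¹) atTop (𝓝 0) := by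
      have := (tendsto_add_atTop_iff_nat 1).2 ENNReal.tendsto_inv_nat_nhds_zero
      simpa using this
    have hOfin : volume O ≠ ⊤ := measure_closedBall_lt_top.ne
    have h2 := ENNReal.Tendsto.const_mul h1 (a := 2 * 80 ^ m * N * volume O) (Or.inr (by finiteness))
    rw [mul_zero] at h2
    refine h2.congr fun l => by ring
  exact le_antisymm (ge_of_tendsto' hlim hbound) bot_le

/-- Almost every linear map sends a compact purely `m`-unrectifiable set of finite `m`-dimensional
measure to a Lebesgue null set. -/
theorem ae_volume_colMap_image_eq_zero {N m : ℕ} {A : Set (Fin N → ℝ)} (hA : IsCompact A)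
    (hfin : μH[m] A ≠ ⊤)
    (hpu : ∀ g : (Fin m → ℝ) → Fin N → ℝ, (∃ K, LipschitzWith K g) → μH[m] (A ∩ range g) = 0) :
    ∀ᵐ L : Fin N → Fin m → ℝ, volume (colMap L '' A) = 0 := by
  set μ : Measure (Fin N → ℝ) := (μH[m]).restrict A with hμ
  have : IsFiniteMeasure μ := ⟨by rw [hμ, Measure.restrict_apply_univ]; exact hfin.lt_top⟩
  have hμA : μ Aᶜ = 0 := by
    rw [hμ, Measure.restrict_apply hA.measurableSet.compl, compl_inter_self, measure_empty]
  have hμle : ∀ s, μ s ≤ μH[m] s := Measure.restrict_le_self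
  filter_upwards [ae_ae_cone_dichotomy hA μ hμA] with L hL
  obtain ⟨K, hK⟩ := exists_lipschitzWith_colMap L
  set B₁ : Set (Fin N → ℝ) := {x ∈ A | ∀ δ : ℝ, 0 < δ → ∃ y ∈ A, 0 < dist y x ∧ dist y x < δ ∧
    colMap L y = colMap L x} with hB₁
  set B₂ : Set (Fin N → ℝ) := {x ∈ A | ∃ d₀, ∀ d, d₀ ≤ d → ∃ j, ∀ M k₀ : ℕ,
    ¬ ConeBound μ j d M k₀ (x, L)} with hB₂
  set B₃ : Set (Fin N → ℝ) := {x ∈ A | x ∉ B₁ ∧ x ∉ B₂} with hB₃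
  have h3 : μ B₃ = 0 := by
    have hpart : ∀ᵐ x ∂μ, ∀ d, x ∉ {x ∈ A | ∀ (j : Fin N) (l : ℕ), ∃ k₀ : ℕ,
        ConeBound μ j d (l + 1 : ℝ≥0∞)⁻¹ k₀ (x, L)} :=
      ae_all_iff.2 fun d => measure_eq_zero_iff_ae_notMem.1 <|
        ae_not_vanishing_cone A μ (fun g hg => le_antisymm
          ((hμle _).trans (hpu g hg).le) bot_le) L d
    rw [measure_eq_zero_iff_ae_notMem]
    filter_upwards [hL, hpart] with x hx1 hx2 ⟨hxA, hn1, hn2⟩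
    apply hn2
    have : ∃ δ : ℝ, 0 < δ ∧ ∀ y ∈ A, 0 < dist y x → dist y x < δ → colMap L y ≠ colMap L x := by
      by_contra hno
      push Not at hno
      exact hn1 ⟨hxA, hno⟩
    obtain ⟨δ, hδ, hδ'⟩ := this
    obtain ⟨d₀, hd₀⟩ := exists_pow_lt_of_lt_one hδ (by norm_num : (1 / 2 : ℝ) < 1)
    refine ⟨hxA, d₀, fun d hd => ?_⟩
    have hnf : ∀ j, ¬ FibreMeets A j d (x, L) := by
      rintro j ⟨y, hyA, hy, hyL⟩
      refine hδ' y hyA hy.1 (hy.2.1.trans_lt (lt_of_le_of_lt ?_ hd₀)) hyL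
      exact pow_le_pow_of_le_one (by norm_num) (by norm_num) hd
    by_contra hno
    push Not at hno
    exact hx2 d ⟨hxA, fun j => hx1 j d (hnf j) (hno j)⟩
  have hv3 : volume (colMap L '' B₃) = 0 := by
    have : μH[m] B₃ = 0 := by
      rw [hμ, Measure.restrict_eq_self _ (fun x hx => hx.1)] at h3
      exact h3
    have h := volume_image_le_hausdorffMeasure (m := m) (hK.lipschitzOnWith (s := B₃))
    rw [this, mul_zero] at h
    exact le_antisymm h bot_le
  have hv1 : volume (colMap L '' B₁) = 0 := volume_image_fibre_accumulation hK hA.measurableSet hfin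
  have hv2 : volume (colMap L '' B₂) = 0 := by
    refine volume_eq_zero_of_infinite_upper_density (μ.map (colMap L)) _ ?_
    rintro _ ⟨x, ⟨hxA, d₀, hd₀⟩, rfl⟩ M δ hδ
    obtain ⟨d₁, hd₁⟩ := exists_pow_lt_of_lt_one hδ (by norm_num : (1 / 2 : ℝ) < 1)
    obtain ⟨j, hj⟩ := hd₀ (max d₀ d₁) (le_max_left _ _)
    have := hj M 0
    simp only [ConeBound] at this
    push Not at this
    obtain ⟨k, -, i, hki⟩ := this
    refine ⟨(1 / 2) ^ (max d₀ d₁ + i) * (1 / 2) ^ k, by positivity, ?_, ?_⟩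
    · rw [← pow_add]
      refine lt_of_le_of_lt (pow_le_pow_of_le_one (by norm_num) (by norm_num) ?_) hd₁
      have := le_max_right d₀ d₁
      omega
    · refine hki.le.trans ?_
      rw [Measure.map_apply hK.continuous.measurable measurableSet_closedBall]
      refine measure_mono fun y hy => ?_
      refine mem_closedBall.2 (hy.2.le.trans ?_)
      rw [mul_comm]
      gcongr
      exact hy.1.2.1
  refine measure_mono_null (t := colMap L '' B₁ ∪ colMap L '' B₂ ∪ colMap L '' B₃) ?_ ?_
  · rw [← image_union, ← image_union]
    refine image_mono fun x hx => ?_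
    by_cases h1 : x ∈ B₁
    · exact Or.inl (Or.inl h1)
    by_cases h2 : x ∈ B₂
    · exact Or.inl (Or.inr h2)
    exact Or.inr ⟨hx, h1, h2⟩
  · exact measure_union_null (measure_union_null hv1 hv2) hv3

lemma hausdorffMeasure_bilipschitz_image_inter_range {X : Type*} [MetricSpace X]
    [MeasurableSpace X] [BorelSpace X] {N m : ℕ} {ξ : (Fin N → ℝ) → X} {S : Set (Fin N → ℝ)}
    {C C' : NNReal} (hξ : LipschitzOnWith C ξ S)
    (hξ' : ∀ x ∈ S, ∀ y ∈ S, dist x y ≤ C' * dist (ξ x) (ξ y))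
    (hpu : ∀ g : (Fin m → ℝ) → Fin N → ℝ, (∃ K, LipschitzWith K g) → μH[m] (S ∩ range g) = 0)
    {g : (Fin m → ℝ) → X} (hg : ∃ K, LipschitzWith K g) : μH[m] (ξ '' S ∩ range g) = 0 := by
  obtain ⟨K, hK⟩ := hg
  have hex : ∀ p, ∃ x, g p ∈ ξ '' S → x ∈ S ∧ ξ x = g p := fun p => by
    by_cases h : g p ∈ ξ '' S
    · obtain ⟨x, hx⟩ := h
      exact ⟨x, fun _ => hx⟩
    · exact ⟨0, fun h' => (h h').elim⟩
  choose σ hσ using hex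
  have hLip : LipschitzOnWith (C' * K) σ (g ⁻¹' (ξ '' S)) := by
    refine LipschitzOnWith.of_dist_le_mul fun p hp q hq => ?_
    refine (hξ' _ (hσ p hp).1 _ (hσ q hq).1).trans ?_
    rw [(hσ p hp).2, (hσ q hq).2, NNReal.coe_mul, mul_assoc]
    gcongr
    exact hK.dist_le_mul p q
  obtain ⟨g', hg', heq⟩ := hLip.extend_pi
  have hsub : ξ '' S ∩ range g ⊆ ξ '' (S ∩ range g') := by
    rintro _ ⟨hy, p, rfl⟩
    exact ⟨σ p, ⟨(hσ p hy).1, p, (heq hy).symm⟩, (hσ p hy).2⟩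
  refine measure_mono_null hsub (le_antisymm ?_ bot_le)
  refine ((hξ.mono inter_subset_left).hausdorffMeasure_image_le (Nat.cast_nonneg m)).trans ?_
  rw [hpu g' ⟨_, hg'⟩, mul_zero]

lemma abs_div_sub_div_le {a b v w δ B d e : ℝ} (hδ : 0 < δ) (hv : δ ≤ |v|) (hw : δ ≤ |w|)
    (hb : |b| ≤ B) (hab : |a - b| ≤ d) (hvw : |v - w| ≤ e) :
    |a / v - b / w| ≤ d / δ + B * e / δ ^ 2 := by
  have hv0 : v ≠ 0 := abs_pos.1 (hδ.trans_le hv)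
  have hw0 : w ≠ 0 := abs_pos.1 (hδ.trans_le hw)
  have hid : a / v - b / w = (a - b) / v - b * (v - w) / (v * w) := by field_simp; ring
  have h1 : |(a - b) / v| ≤ d / δ := by
    rw [abs_div]
    exact div_le_div₀ ((abs_nonneg _).trans hab) hab hδ hv
  have h2 : |b * (v - w) / (v * w)| ≤ B * e / δ ^ 2 := by
    rw [abs_div, abs_mul, abs_mul, sq]
    have hB : 0 ≤ B := (abs_nonneg _).trans hb
    have he : 0 ≤ e := (abs_nonneg _).trans hvw
    exact div_le_div₀ (by positivity) (by gcongr) (by positivity) (by gcongr)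
  rw [hid]
  exact (abs_sub _ _).trans (add_le_add h1 h2)

lemma abs_dotProduct_sub_le {n : ℕ} (l x y : Fin n → ℝ) :
    |l ⬝ᵥ x - l ⬝ᵥ y| ≤ (∑ i, |l i|) * dist x y := by
  rw [← dotProduct_sub, dotProduct, Finset.sum_mul]
  refine (Finset.abs_sum_le_sum_abs _ _).trans (Finset.sum_le_sum fun i _ => ?_)
  rw [abs_mul]
  gcongr
  exact dist_le_pi_dist x y i

lemma ae_volume_projective_image {n m : ℕ} {A : Set (Fin n → ℝ)} (hA : IsCompact A)
    (hfin : μH[m] A ≠ ⊤)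
    (hpu : ∀ g : (Fin m → ℝ) → Fin n → ℝ, (∃ K, LipschitzWith K g) → μH[m] (A ∩ range g) = 0)
    (l : Fin n → ℝ) (s : ℝ) {δ : ℝ} (hδ : 0 < δ) :
    ∀ᵐ L : Fin (n + 1) → Fin m → ℝ, volume {p : Fin m → ℝ | ∃ x ∈ A, δ ≤ |l ⬝ᵥ x + s| ∧
      ∀ a, p a * (l ⬝ᵥ x + s) = L 0 a + ∑ i, x i * L i.succ a} = 0 := by
  set S : Set (Fin n → ℝ) := {x ∈ A | δ ≤ |l ⬝ᵥ x + s|} with hS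
  have hcont : Continuous fun x : Fin n → ℝ => l ⬝ᵥ x + s := by
    unfold dotProduct; fun_prop
  have hSA : S ⊆ A := fun x hx => hx.1
  have hScpt : IsCompact S := hA.inter_right (isClosed_le continuous_const hcont.abs)
  set v : (Fin n → ℝ) → ℝ := fun x => l ⬝ᵥ x + s with hv
  obtain ⟨V, hV⟩ := (hA.image hcont).isBounded.exists_norm_le
  obtain ⟨B, hB⟩ := hA.isBounded.exists_norm_le
  set V' := max V 1
  set B' := max B 1
  have hV1 : 0 < V' := lt_of_lt_of_le one_pos (le_max_right _ _)
  have hB1 : 0 < B' := lt_of_lt_of_le one_pos (le_max_right _ _)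
  have hvV : ∀ x ∈ S, |v x| ≤ V' := fun x hx => (hV _ ⟨x, hx.1, rfl⟩).trans (le_max_left _ _)
  have hxB : ∀ x ∈ S, ∀ i, |x i| ≤ B' := fun x hx i =>
    (norm_le_pi_norm x i).trans ((hB x hx.1).trans (le_max_left _ _))
  have hv0 : ∀ x ∈ S, v x ≠ 0 := fun x hx => abs_pos.1 (hδ.trans_le hx.2)
  set c := ∑ i, |l i|
  have hc0 : 0 ≤ c := Finset.sum_nonneg fun i _ => abs_nonneg _
  have hvc : ∀ x y, |v x - v y| ≤ c * dist x y := fun x y => by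
    simpa [hv] using abs_dotProduct_sub_le l x y
  set ξ : (Fin n → ℝ) → Fin (n + 1) → ℝ := fun x j => (Fin.cons 1 x : Fin (n + 1) → ℝ) j / v x
    with hξ
  have hcons : ∀ x ∈ S, ∀ j, |(Fin.cons 1 x : Fin (n + 1) → ℝ) j| ≤ B' := fun x hx j => by
    refine Fin.cases ?_ (fun i => ?_) j
    · rw [Fin.cons_zero, abs_one]
      exact le_max_right B 1
    · simpa using hxB x hx i
  have hcons' : ∀ x y : Fin n → ℝ, ∀ j, |(Fin.cons 1 x : Fin (n + 1) → ℝ) j -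
      (Fin.cons 1 y : Fin (n + 1) → ℝ) j| ≤ dist x y := fun x y j => by
    refine Fin.cases ?_ (fun i => ?_) j
    · simp
    · rw [Fin.cons_succ, Fin.cons_succ]
      exact dist_le_pi_dist x y i
  have hLip : LipschitzOnWith (1 / δ + B' * c / δ ^ 2).toNNReal ξ S := by
    refine LipschitzOnWith.of_dist_le_mul fun x hx y hy => ?_
    rw [Real.coe_toNNReal _ (by positivity), dist_pi_le_iff (by positivity)]
    intro j
    refine (abs_div_sub_div_le hδ hx.2 hy.2 (hcons y hy j) (hcons' x y j) (hvc x y)).trans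
      (le_of_eq ?_)
    ring
  have hanti : ∀ x ∈ S, ∀ y ∈ S,
      dist x y ≤ (V' + B' / δ * V' ^ 2).toNNReal * dist (ξ x) (ξ y) := fun x hx y hy => by
    rw [Real.coe_toNNReal _ (by positivity), dist_pi_le_iff (by positivity)]
    intro i
    have hdiv : ∀ z ∈ S, z i = ξ z i.succ / ξ z 0 := fun z hz => by
      have := hv0 z hz
      simp only [hξ, Fin.cons_succ, Fin.cons_zero]
      field_simp
    have hlow : ∀ z ∈ S, V'⁻¹ ≤ |ξ z 0| := fun z hz => by
      simp only [hξ, Fin.cons_zero, one_div, abs_inv]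
      exact inv_anti₀ (abs_pos.2 (hv0 z hz)) (hvV z hz)
    rw [Real.dist_eq, hdiv x hx, hdiv y hy]
    refine (abs_div_sub_div_le (B := B' / δ) (inv_pos.2 hV1) (hlow x hx) (hlow y hy) ?_
      (dist_le_pi_dist (ξ x) (ξ y) i.succ) (dist_le_pi_dist (ξ x) (ξ y) 0)).trans (le_of_eq ?_)
    · simp only [hξ, abs_div]
      exact div_le_div₀ hB1.le (hcons y hy _) hδ hy.2
    · field_simp
  have hBF := ae_volume_colMap_image_eq_zero (m := m) (hScpt.image_of_continuousOn hLip.continuousOn)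
    (ne_top_of_le_ne_top (ENNReal.mul_ne_top (by finiteness)
      (ne_top_of_le_ne_top hfin (measure_mono hSA)))
      (hLip.hausdorffMeasure_image_le (Nat.cast_nonneg m)))
    (fun g hg => hausdorffMeasure_bilipschitz_image_inter_range hLip hanti
      (fun g hg => measure_mono_null (inter_subset_inter_left _ hSA) (hpu g hg)) hg)
  filter_upwards [hBF] with L hL
  refine measure_mono_null ?_ hL
  rintro p ⟨x, hxA, hxδ, hp⟩
  refine ⟨ξ x, ⟨x, ⟨hxA, hxδ⟩, rfl⟩, funext fun a => ?_⟩
  have h0 := hv0 x ⟨hxA, hxδ⟩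
  have : p a = (L 0 a + ∑ i, x i * L i.succ a) / v x := by rw [eq_div_iff h0]; exact hp a
  rw [this, colMap, Finset.sum_apply, Fin.sum_univ_succ, add_div, Finset.sum_div]
  simp only [hξ, Pi.smul_apply, smul_eq_mul, Fin.cons_zero, Fin.cons_succ]
  congr 1
  · ring
  · exact Finset.sum_congr rfl fun i _ => by ring

/-- The projective image of `A` whose numerators are the affine functions with indices `ι` and whose
denominator is the affine function with index `k`. -/
def projectiveImage {n m : ℕ} (A : Set (Fin n → ℝ)) (k : Fin n) (ι : Fin m → Fin n) (δ : ℝ)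
    (T : Fin n → Fin n → ℝ) (t : Fin n → ℝ) : Set (Fin m → ℝ) :=
  {p | ∃ x ∈ A, δ ≤ |T k ⬝ᵥ x + t k| ∧ ∀ a, p a * (T k ⬝ᵥ x + t k) = T (ι a) ⬝ᵥ x + t (ι a)}

/-- Extraction of the parameters relevant to `projectiveImage`. -/
def projectiveParams {n m : ℕ} (k : Fin n) (ι : Fin m → Fin n) :
    ((Fin n → Fin n → ℝ) × (Fin n → ℝ)) →ₗ[ℝ]
      ((Fin n → ℝ) × ℝ) × (Fin (n + 1) → Fin m → ℝ) where
  toFun w := ((w.1 k, w.2 k), fun j a => (Fin.cons (w.2 (ι a)) (w.1 (ι a)) : Fin (n + 1) → ℝ) j)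
  map_add' w w' := by
    refine Prod.ext rfl (funext fun j => funext fun a => ?_)
    refine Fin.cases ?_ (fun i => ?_) j <;> simp
  map_smul' c w := by
    refine Prod.ext rfl (funext fun j => funext fun a => ?_)
    refine Fin.cases ?_ (fun i => ?_) j <;> simp

lemma surjective_projectiveParams {n m : ℕ} {k : Fin n} {ι : Fin m → Fin n}
    (hι : Function.Injective ι) (hk : k ∉ range ι) :
    Function.Surjective (projectiveParams k ι) := by
  rintro ⟨⟨l, s⟩, L⟩
  refine ⟨⟨fun r => if r = k then l else Function.extend ι (fun a i => L (Fin.succ i) a) 0 r,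
    fun r => if r = k then s else Function.extend ι (fun a => L 0 a) 0 r⟩, ?_⟩
  have hne : ∀ a, ι a ≠ k := fun a h => hk ⟨a, h⟩
  refine Prod.ext (Prod.ext ?_ ?_) (funext fun j => funext fun a => ?_)
  · simp [projectiveParams]
  · simp [projectiveParams]
  · refine Fin.cases ?_ (fun i => ?_) j <;> simp [projectiveParams, hne, hι.extend_apply]

/-- The parameter space of `projectiveParams`. -/
abbrev ProjectiveParam (n m : ℕ) := ((Fin n → ℝ) × ℝ) × (Fin (n + 1) → Fin m → ℝ)

lemma ae_volume_projectiveImage {n m : ℕ} {A : Set (Fin n → ℝ)} (hA : IsCompact A)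
    (hfin : μH[m] A ≠ ⊤)
    (hpu : ∀ g : (Fin m → ℝ) → Fin n → ℝ, (∃ K, LipschitzWith K g) → μH[m] (A ∩ range g) = 0)
    {k : Fin n} {ι : Fin m → Fin n} (hι : Function.Injective ι) (hk : k ∉ range ι)
    {δ : ℝ} (hδ : 0 < δ) :
    ∀ᵐ w : (Fin n → Fin n → ℝ) × (Fin n → ℝ), volume (projectiveImage A k ι δ w.1 w.2) = 0 := by
  let sec : ProjectiveParam n m → Set (Fin m → ℝ) := fun w => {p | ∃ x ∈ A, δ ≤ |w.1.1 ⬝ᵥ x + w.1.2| ∧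
      ∀ a, p a * (w.1.1 ⬝ᵥ x + w.1.2) = w.2 0 a + ∑ i, x i * w.2 i.succ a}
  have hmeas : MeasurableSet {w : ProjectiveParam n m | volume (sec w) = 0} := by
    have hcont : Continuous fun q : (ProjectiveParam n m × (Fin m → ℝ)) × (Fin n → ℝ) =>
        q.1.1.1.1 ⬝ᵥ q.2 + q.1.1.1.2 := by
      unfold dotProduct; fun_prop
    have h1 : IsClosed {q : (ProjectiveParam n m × (Fin m → ℝ)) × (Fin n → ℝ) |
        δ ≤ |q.1.1.1.1 ⬝ᵥ q.2 + q.1.1.1.2|} := isClosed_le continuous_const hcont.abs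
    have h2 : IsClosed {q : (ProjectiveParam n m × (Fin m → ℝ)) × (Fin n → ℝ) | ∀ a,
        q.1.2 a * (q.1.1.1.1 ⬝ᵥ q.2 + q.1.1.1.2) =
          q.1.1.2 0 a + ∑ i, q.2 i * q.1.1.2 i.succ a} := by
      simp only [ofPred_forall]
      refine isClosed_iInter fun a => isClosed_eq ?_ (by fun_prop)
      exact Continuous.mul (by fun_prop) hcont
    have h3 := (isClosed_setOf_exists_mem_compact hA (h1.inter h2)).measurableSet
    exact measurable_measure_prodMk_left h3 (measurableSet_singleton 0)
  have hae : ∀ᵐ w : ProjectiveParam n m, volume (sec w) = 0 := by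
    rw [Measure.volume_eq_prod, Measure.ae_prod_iff_ae_ae hmeas]
    exact ae_of_all _ fun q => ae_volume_projective_image hA hfin hpu q.1 q.2 hδ
  have hI₁ : (volume : Measure (Fin n → Fin n → ℝ)).IsAddHaarMeasure :=
    Measure.pi.isAddHaarMeasure _
  have hI₂ : (volume : Measure (Fin (n + 1) → Fin m → ℝ)).IsAddHaarMeasure :=
    Measure.pi.isAddHaarMeasure _
  have hI₃ : ((volume : Measure (Fin n → Fin n → ℝ)).prod
      (volume : Measure (Fin n → ℝ))).IsAddHaarMeasure := Measure.prod.instIsAddHaarMeasure _ _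
  have hI₄ : (((volume : Measure (Fin n → ℝ)).prod (volume : Measure ℝ)).prod
      (volume : Measure (Fin (n + 1) → Fin m → ℝ))).IsAddHaarMeasure :=
    Measure.prod.instIsAddHaarMeasure _ _
  have := (ae_comp_linearMap_mem_iff (projectiveParams k ι) (volume.prod volume)
    ((volume.prod volume).prod volume)
    (surjective_projectiveParams hι hk) hmeas).2 hae
  filter_upwards [this] with w hw
  refine measure_mono_null ?_ hw
  rintro p ⟨x, hx, hxδ, hp⟩
  refine ⟨x, hx, hxδ, fun a => (hp a).trans ?_⟩
  simp [projectiveParams, dotProduct, mul_comm, add_comm]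

/-- A single invertible linear change of coordinates for which all projective images at all integer
scales are null, for almost every translation. -/
lemma exists_linear_generic {n m : ℕ} {A : Set (Fin n → ℝ)} (hA : IsCompact A)
    (hfin : μH[m] A ≠ ⊤)
    (hpu : ∀ g : (Fin m → ℝ) → Fin n → ℝ, (∃ K, LipschitzWith K g) → μH[m] (A ∩ range g) = 0) :
    ∃ T : Matrix (Fin n) (Fin n) ℝ, T.det ≠ 0 ∧ ∀ N : ℕ, N ≠ 0 → ∀ᵐ t : Fin n → ℝ,
      ∀ (q : Fin n → ℤ) (k : Fin n) (ι : Fin m → Fin n), Function.Injective ι → k ∉ range ι →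
      ∀ i : ℕ, volume (projectiveImage A k ι (1 / (i + 1 : ℝ)) ((N : ℝ) • T)
        (fun r => t r - q r)) = 0 := by
  let P : (Fin n → Fin n → ℝ) → (Fin n → ℝ) → Prop := fun T t =>
    ∀ (k : Fin n) (ι : Fin m → Fin n), Function.Injective ι → k ∉ range ι →
      ∀ i : ℕ, volume (projectiveImage A k ι (1 / (i + 1 : ℝ)) T t) = 0
  have h1 : ∀ᵐ w : (Fin n → Fin n → ℝ) × (Fin n → ℝ), P w.1 w.2 := by
    simp only [P, eventually_countable_forall]
    intro k ι hι hk i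
    exact ae_volume_projectiveImage hA hfin hpu hι hk (by positivity)
  have h2 : ∀ᵐ T : Fin n → Fin n → ℝ, ∀ᵐ t : Fin n → ℝ, ∀ q : Fin n → ℤ,
      P T (fun r => t r - q r) := by
    rw [Measure.volume_eq_prod] at h1
    filter_upwards [Measure.ae_ae_of_ae_prod h1] with T hT
    refine ae_all_iff.2 fun q => ?_
    exact (measurePreserving_sub_right volume (fun r => (q r : ℝ))).quasiMeasurePreserving.ae hT
  have h3 : ∀ᵐ T : Fin n → Fin n → ℝ, ∀ N : ℕ, N ≠ 0 → ∀ᵐ t : Fin n → ℝ, ∀ q : Fin n → ℤ,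
      P ((N : ℝ) • T) (fun r => t r - q r) := by
    refine ae_all_iff.2 fun N => ?_
    by_cases hN : N = 0
    · simp [hN]
    have hq := Measure.quasiMeasurePreserving_smul (volume : Measure (Fin n → Fin n → ℝ))
      (Nat.cast_ne_zero.2 hN : (N : ℝ) ≠ 0)
    filter_upwards [hq.ae h2] with T hT _ using hT
  have hopen : IsOpen {T : Fin n → Fin n → ℝ | Matrix.det (Matrix.of T) ≠ 0} := by
    refine isOpen_ne_fun ?_ continuous_const
    exact Continuous.matrix_det continuous_id
  have hpos : 0 < volume {T : Fin n → Fin n → ℝ | Matrix.det (Matrix.of T) ≠ 0} :=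
    hopen.measure_pos volume ⟨(1 : Matrix (Fin n) (Fin n) ℝ), by
      show Matrix.det (1 : Matrix (Fin n) (Fin n) ℝ) ≠ 0
      simp⟩
  obtain ⟨T, hTdet, hT⟩ : ∃ T ∈ {T : Fin n → Fin n → ℝ | Matrix.det (Matrix.of T) ≠ 0},
      ∀ N : ℕ, N ≠ 0 → ∀ᵐ t : Fin n → ℝ, ∀ q : Fin n → ℤ,
      P ((N : ℝ) • T) (fun r => t r - q r) := by
    by_contra hno
    push Not at hno
    refine hpos.ne' (measure_mono_null (fun T hTd => ?_) h3)
    intro hgood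
    obtain ⟨N, hN, hbad⟩ := hno T hTd
    exact hbad ((hgood N hN).mono fun t ht => by simpa using ht)
  exact ⟨T, hTdet, hT⟩

/-- Truncation to `[-1/2, 1/2]`. -/
def clampHalf (y : ℝ) : ℝ := max (-1 / 2) (min (1 / 2) y)

lemma abs_clampHalf_le (y : ℝ) : |clampHalf y| ≤ 1 / 2 := by
  unfold clampHalf
  rw [abs_le]
  constructor
  · exact (by norm_num : -(1 / 2 : ℝ) ≤ -1 / 2).trans (le_max_left _ _)
  · exact max_le (by norm_num) (min_le_left _ _)

lemma abs_clampHalf_sub_le (y z : ℝ) : |clampHalf y - clampHalf z| ≤ |y - z| := by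
  have h := ((LipschitzWith.id (α := ℝ)).const_min (1 / 2)).const_max (-1 / 2)
  simpa [clampHalf, Real.dist_eq] using h.dist_le_mul y z

lemma clampHalf_of_abs_le {y : ℝ} (h : |y| ≤ 1 / 2) : clampHalf y = y := by
  rw [abs_le] at h
  rw [clampHalf, min_eq_right h.2, max_eq_right (by linarith)]

lemma clampHalf_of_le {y : ℝ} (h : 1 / 2 ≤ y) : clampHalf y = 1 / 2 := by
  rw [clampHalf, min_eq_left h, max_eq_right (by norm_num)]

lemma clampHalf_of_le_neg {y : ℝ} (h : y ≤ -1 / 2) : clampHalf y = -1 / 2 := by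
  rw [clampHalf, min_eq_right (by linarith), max_eq_left h]

/-- In each unit cell centred at an integer, dilate by `1 / s` and truncate to the cell. -/
def cellPush (s z : ℝ) : ℝ := round z + clampHalf ((z - round z) / s)

lemma cellPush_one (z : ℝ) : cellPush 1 z = z := by
  rw [cellPush, div_one, clampHalf_of_abs_le (abs_sub_round z)]
  ring

lemma abs_cellPush_sub_le (s z : ℝ) : |cellPush s z - z| ≤ 1 := by
  have h1 := abs_clampHalf_le ((z - round z) / s)
  have h2 := abs_sub_round z
  rw [abs_le] at *
  unfold cellPush
  constructor <;> linarith

lemma abs_cellPush_sub_cellPush_le {s : ℝ} (hs : 0 < s) (hs1 : s ≤ 1) (z z' : ℝ) :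
    |cellPush s z - cellPush s z'| ≤ |z - z'| / s := by
  wlog h : z' ≤ z generalizing z z'
  · rw [abs_sub_comm, abs_sub_comm z]
    exact this z' z (not_le.1 h).le
  have hr := abs_sub_round z
  have hr' := abs_sub_round z'
  rw [abs_le] at hr hr'
  have hmono : round z' ≤ round z := by
    rw [round_eq, round_eq]
    exact Int.floor_mono (by linarith)
  rcases hmono.eq_or_lt with heq | hlt
  · unfold cellPush
    rw [heq, add_sub_add_left_eq_sub]
    refine (abs_clampHalf_sub_le _ _).trans (le_of_eq ?_)
    rw [← sub_div, abs_div, abs_of_pos hs, sub_sub_sub_cancel_right]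
  · have hq : (round z' : ℝ) + 1 ≤ round z := by exact_mod_cast hlt
    have hlow : 1 / 2 - clampHalf ((z' - round z') / s) ≤ (1 / 2 - (z' - round z')) / s := by
      have h1 : min (1 / 2) ((z' - round z') / s) ≤ clampHalf ((z' - round z') / s) :=
        le_max_right _ _
      rcases min_choice (1 / 2) ((z' - round z') / s) with hc | hc <;> rw [hc] at h1
      · have : 0 ≤ (1 / 2 - (z' - round z')) / s := div_nonneg (by linarith) hs.le
        linarith
      · rw [sub_div (1 / 2) (z' - round z')]
        have : (1 / 2 : ℝ) ≤ 1 / 2 / s := by rw [le_div_iff₀ hs]; linarith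
        linarith
    have hhigh : clampHalf ((z - round z) / s) + 1 / 2 ≤ (z - round z + 1 / 2) / s := by
      have h0 : 0 ≤ (z - round z + 1 / 2) / s := div_nonneg (by linarith) hs.le
      have h2 : (1 / 2 : ℝ) ≤ 1 / 2 / s := by rw [le_div_iff₀ hs]; linarith
      have : clampHalf ((z - round z) / s) ≤ (z - round z + 1 / 2) / s - 1 / 2 := by
        refine max_le (by linarith) ((min_le_right _ _).trans ?_)
        rw [add_div]
        linarith
      linarith
    have hmid : (round z : ℝ) - round z' - 1 ≤ (round z - round z' - 1) / s := by
      rw [le_div_iff₀ hs]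
      nlinarith
    have hb := abs_clampHalf_le ((z - round z) / s)
    have hb' := abs_clampHalf_le ((z' - round z') / s)
    rw [abs_le] at hb hb'
    have hsum : (z - z') / s = (round z - round z' - 1) / s + (1 / 2 - (z' - round z')) / s +
        (z - round z + 1 / 2) / s := by ring
    rw [abs_of_nonneg (sub_nonneg.2 h), hsum, abs_le]
    unfold cellPush
    constructor <;> linarith

lemma abs_cellPush_sub_cellPush_le_of_scale {s s' σ : ℝ} (hσ : 0 < σ) (hs : σ ≤ s)
    (hs' : σ ≤ s') (z : ℝ) :
    |cellPush s z - cellPush s' z| ≤ |s - s'| / (2 * σ) := by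
  wlog h : s ≤ s' generalizing s s'
  · rw [abs_sub_comm, abs_sub_comm s]
    exact this hs' hs (not_le.1 h).le
  have hs0 : 0 < s := hσ.trans_le hs
  have hs0' : 0 < s' := hσ.trans_le hs'
  have hr := abs_sub_round z
  unfold cellPush
  rw [add_sub_add_left_eq_sub]
  set u := z - round z
  have hgoal : (s' - s) / (2 * s') ≤ |s - s'| / (2 * σ) := by
    rw [abs_sub_comm, abs_of_nonneg (sub_nonneg.2 h)]
    exact div_le_div_of_nonneg_left (sub_nonneg.2 h) (by positivity) (by linarith)
  refine le_trans ?_ hgoal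
  rcases le_total |u| (s / 2) with hu | hu
  · refine (abs_clampHalf_sub_le _ _).trans ?_
    have : u / s - u / s' = u * (s' - s) / (s * s') := by field_simp
    rw [this, abs_div, abs_mul, abs_of_nonneg (sub_nonneg.2 h), abs_of_pos (by positivity : 0 < s * s'),
      div_le_div_iff₀ (by positivity) (by positivity)]
    have := mul_le_mul_of_nonneg_right hu (mul_nonneg (sub_nonneg.2 h) hs0'.le)
    nlinarith
  · have hle : s / (2 * s') ≤ |u| / s' := by
      rw [div_le_div_iff₀ (by positivity) hs0']
      nlinarith
    have hval : (s' - s) / (2 * s') = 1 / 2 - s / (2 * s') := by field_simp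
    rcases abs_cases u with ⟨hau, _⟩ | ⟨hau, _⟩ <;> rw [hau] at hu hr hle
    · have h1 : clampHalf (u / s) = 1 / 2 := clampHalf_of_le (by rw [le_div_iff₀ hs0]; linarith)
      have h2 : min (1 / 2) (u / s') ≤ clampHalf (u / s') := le_max_right _ _
      have h3 : s / (2 * s') ≤ min (1 / 2) (u / s') :=
        le_min (by rw [div_le_div_iff₀ (by positivity) (by norm_num)]; linarith) hle
      have h4 := abs_clampHalf_le (u / s')
      rw [abs_le] at h4
      rw [h1, hval, abs_of_nonneg (by linarith)]
      linarith
    · have h1 : clampHalf (u / s) = -1 / 2 :=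
        clampHalf_of_le_neg (by rw [div_le_iff₀ hs0]; linarith)
      have h3 : clampHalf (u / s') ≤ -(s / (2 * s')) := by
        refine max_le ?_ ((min_le_right _ _).trans ?_)
        · have : s / (2 * s') ≤ 1 / 2 := by
            rw [div_le_div_iff₀ (by positivity) (by norm_num)]; linarith
          linarith
        · rw [neg_div] at hle; linarith
      have h4 := abs_clampHalf_le (u / s')
      rw [abs_le] at h4
      rw [h1, hval, abs_of_nonpos (by linarith)]
      linarith

lemma abs_cellPush_sub_cellPush_le_add {s s' σ : ℝ} (hσ : 0 < σ) (hs : σ ≤ s) (hs1 : s ≤ 1)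
    (hs' : σ ≤ s') (z z' : ℝ) :
    |cellPush s z - cellPush s' z'| ≤ (|z - z'| + |s - s'| / 2) / σ := by
  have h1 := abs_cellPush_sub_cellPush_le (hσ.trans_le hs) hs1 z z'
  have h2 := abs_cellPush_sub_cellPush_le_of_scale hσ hs hs' z'
  have h3 : |z - z'| / s ≤ |z - z'| / σ := div_le_div_of_nonneg_left (abs_nonneg _) hσ hs
  have h4 : (|z - z'| + |s - s'| / 2) / σ = |z - z'| / σ + |s - s'| / (2 * σ) := by
    field_simp
  rw [h4]
  exact (abs_sub_le _ (cellPush s z') _).trans (by linarith)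

/-- Twice the distance to the nearest integer. -/
def gridGap (z : ℝ) : ℝ := 2 * |z - round z|

lemma gridGap_nonneg (z : ℝ) : 0 ≤ gridGap z := by unfold gridGap; positivity

lemma gridGap_le_one (z : ℝ) : gridGap z ≤ 1 := by
  have := abs_sub_round z
  unfold gridGap; linarith

lemma abs_gridGap_sub_le (z z' : ℝ) : |gridGap z - gridGap z'| ≤ 2 * |z - z'| := by
  have key : ∀ a b : ℝ, |a - round a| ≤ |b - round b| + |a - b| := fun a b => by
    refine (round_le a (round b)).trans ?_
    have := abs_sub_le a b (round b)
    linarith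
  have h1 := key z z'
  have h2 := key z' z
  rw [abs_sub_comm z' z] at h2
  unfold gridGap
  rw [abs_le]
  constructor <;> linarith

/-- The smallest `r` such that at least `m + 1` of the coordinates have `gridGap` at most `r`. -/
def codimGap {n : ℕ} (m : ℕ) [Nonempty (Fin (m + 1) ↪ Fin n)] (z : Fin n → ℝ) : ℝ :=
  Finset.univ.inf' Finset.univ_nonempty fun κ : Fin (m + 1) ↪ Fin n => ‖fun a => gridGap (z (κ a))‖

section codimGap

variable {n m : ℕ} [Nonempty (Fin (m + 1) ↪ Fin n)]

lemma exists_codimGap_eq (z : Fin n → ℝ) :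
    ∃ κ : Fin (m + 1) ↪ Fin n, codimGap m z = ‖fun a => gridGap (z (κ a))‖ := by
  obtain ⟨κ, -, h⟩ := Finset.exists_mem_eq_inf' Finset.univ_nonempty
    fun κ : Fin (m + 1) ↪ Fin n => ‖fun a => gridGap (z (κ a))‖
  exact ⟨κ, h⟩

lemma codimGap_le (z : Fin n → ℝ) (κ : Fin (m + 1) ↪ Fin n) :
    codimGap m z ≤ ‖fun a => gridGap (z (κ a))‖ :=
  Finset.inf'_le _ (Finset.mem_univ κ)

lemma codimGap_nonneg (z : Fin n → ℝ) : 0 ≤ codimGap m z := by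
  obtain ⟨κ, h⟩ := exists_codimGap_eq (m := m) z
  rw [h]
  exact norm_nonneg _

lemma codimGap_le_one (z : Fin n → ℝ) : codimGap m z ≤ 1 := by
  obtain ⟨κ⟩ := ‹Nonempty (Fin (m + 1) ↪ Fin n)›
  refine (codimGap_le z κ).trans ((pi_norm_le_iff_of_nonneg zero_le_one).2 fun a => ?_)
  rw [Real.norm_of_nonneg (gridGap_nonneg _)]
  exact gridGap_le_one _

lemma abs_codimGap_sub_le (z z' : Fin n → ℝ) :
    |codimGap m z - codimGap m z'| ≤ 2 * dist z z' := by
  have key : ∀ z z' : Fin n → ℝ, codimGap m z ≤ codimGap m z' + 2 * dist z z' := fun z z' => by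
    obtain ⟨κ, h⟩ := exists_codimGap_eq (m := m) z'
    rw [h]
    refine (codimGap_le z κ).trans ((pi_norm_le_iff_of_nonneg (by positivity)).2 fun a => ?_)
    have h1 := norm_le_pi_norm (fun a => gridGap (z' (κ a))) a
    rw [Real.norm_of_nonneg (gridGap_nonneg _)] at h1 ⊢
    have h2 := abs_gridGap_sub_le (z (κ a)) (z' (κ a))
    have h3 := dist_le_pi_dist z z' (κ a)
    rw [Real.dist_eq] at h3
    have h4 := le_abs_self (gridGap (z (κ a)) - gridGap (z' (κ a)))
    linarith
  have h1 := key z z'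
  have h2 := key z' z
  rw [dist_comm] at h2
  rw [abs_le]
  constructor <;> linarith

lemma continuous_codimGap : Continuous (codimGap m : (Fin n → ℝ) → ℝ) :=
  (LipschitzWith.of_dist_le_mul (K := 2) fun z z' => abs_codimGap_sub_le z z').continuous

lemma exists_forall_gridGap_le {z : Fin n → ℝ} {r : ℝ} (h : codimGap m z ≤ r) :
    ∃ κ : Fin (m + 1) ↪ Fin n, ∀ a, gridGap (z (κ a)) ≤ r := by
  obtain ⟨κ, hκ⟩ := exists_codimGap_eq (m := m) z
  refine ⟨κ, fun a => ?_⟩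
  have h1 := norm_le_pi_norm (fun a => gridGap (z (κ a))) a
  rw [Real.norm_of_nonneg (gridGap_nonneg _)] at h1
  linarith

lemma exists_gridGap_eq_codimGap (z : Fin n → ℝ) : ∃ k, gridGap (z k) = codimGap m z := by
  obtain ⟨κ, hκ⟩ := exists_codimGap_eq (m := m) z
  obtain ⟨a, ha⟩ := Finite.exists_max fun a => gridGap (z (κ a))
  refine ⟨κ a, ?_⟩
  rw [hκ]
  refine le_antisymm ?_ ((pi_norm_le_iff_of_nonneg (gridGap_nonneg _)).2 fun b => ?_)
  · exact (le_abs_self _).trans (norm_le_pi_norm (fun a => gridGap (z (κ a))) a)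
  · rw [Real.norm_of_nonneg (gridGap_nonneg _)]
    exact ha b

lemma card_gridGap_lt_codimGap (z : Fin n → ℝ) :
    (Finset.univ.filter fun i => gridGap (z i) < codimGap m z).card ≤ m := by
  by_contra! hcard
  obtain ⟨J, hJ, hJcard⟩ := Finset.exists_subset_card_eq (Nat.succ_le_of_lt hcard)
  let κ : Fin (m + 1) ↪ Fin n := (J.orderEmbOfFin hJcard).toEmbedding
  have hκ : ∀ a, gridGap (z (κ a)) < codimGap m z := fun a =>
    (Finset.mem_filter.1 (hJ (Finset.orderEmbOfFin_mem J hJcard a))).2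
  have hpos : 0 < codimGap m z := (gridGap_nonneg _).trans_lt (hκ 0)
  refine (codimGap_le z κ).not_gt ((pi_norm_lt_iff hpos).2 fun a => ?_)
  rw [Real.norm_of_nonneg (gridGap_nonneg _)]
  exact hκ a

/-- The coordinates of small gap fit into `m` slots avoiding one that attains `codimGap`. -/
lemma exists_injective_slots (z : Fin n → ℝ) :
    ∃ (k : Fin n) (ι : Fin m → Fin n), Function.Injective ι ∧ k ∉ range ι ∧
      gridGap (z k) = codimGap m z ∧ ∀ i ∉ range ι, codimGap m z ≤ gridGap (z i) := by
  obtain ⟨k, hk⟩ := exists_gridGap_eq_codimGap (m := m) z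
  have hmn : m + 1 ≤ n := by
    obtain ⟨κ⟩ := ‹Nonempty (Fin (m + 1) ↪ Fin n)›
    simpa using Fintype.card_le_of_embedding κ
  obtain ⟨J, hIJ, hJk, hJ⟩ := Finset.exists_subsuperset_card_eq
    (s := Finset.univ.filter fun i => gridGap (z i) < codimGap m z) (t := Finset.univ.erase k)
    (n := m) (fun i hi => Finset.mem_erase.2 ⟨fun h => by
      rw [Finset.mem_filter, h, hk] at hi; exact lt_irrefl _ hi.2, Finset.mem_univ i⟩)
    (card_gridGap_lt_codimGap z)
    (by rw [Finset.card_erase_of_mem (Finset.mem_univ k), Finset.card_univ, Fintype.card_fin]; omega)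
  have hr : range (J.orderEmbOfFin hJ) = J := Finset.range_orderEmbOfFin J hJ
  refine ⟨k, J.orderEmbOfFin hJ, (J.orderEmbOfFin hJ).injective, ?_, hk, fun i hi => ?_⟩
  · rw [hr]
    exact fun h => Finset.notMem_erase k _ (hJk h)
  · rw [hr] at hi
    by_contra! hlt
    exact hi (hIJ (Finset.mem_filter.2 ⟨Finset.mem_univ i, hlt⟩))

end codimGap

lemma volume_gridGap_le (y r : ℝ) :
    volume {τ ∈ Icc (0 : ℝ) 1 | gridGap (y + τ) ≤ r} ≤ ENNReal.ofReal (3 * r) := by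
  have hsub : {τ ∈ Icc (0 : ℝ) 1 | gridGap (y + τ) ≤ r} ⊆
      ⋃ q ∈ Finset.Icc ⌊y⌋ (⌊y⌋ + 2), closedBall ((q : ℝ) - y) (r / 2) := by
    rintro τ ⟨⟨h0, h1⟩, hτ⟩
    have hr := abs_sub_round (y + τ)
    rw [abs_le] at hr
    have hf := Int.floor_le y
    have hf' := Int.lt_floor_add_one y
    have h2 : ⌊y⌋ - 1 < round (y + τ) := by
      have : (⌊y⌋ : ℝ) - 1 < round (y + τ) := by linarith
      exact_mod_cast this
    have h3 : round (y + τ) < ⌊y⌋ + 3 := by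
      have : (round (y + τ) : ℝ) < ⌊y⌋ + 3 := by linarith
      exact_mod_cast this
    simp only [mem_iUnion]
    refine ⟨round (y + τ), Finset.mem_Icc.2 ⟨by omega, by omega⟩, ?_⟩
    rw [mem_closedBall, Real.dist_eq]
    unfold gridGap at hτ
    have : τ - (round (y + τ) - y) = y + τ - round (y + τ) := by ring
    rw [this]
    linarith
  refine (measure_mono hsub).trans ((measure_biUnion_finset_le _ _).trans ?_)
  simp only [Real.volume_closedBall, Finset.sum_const, Int.card_Icc]
  have hc : (⌊y⌋ + 2 + 1 - ⌊y⌋).toNat = 3 := by omega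
  have hr : 2 * (r / 2) = r := by ring
  rw [hc, hr, ENNReal.ofReal_mul (by norm_num : (0 : ℝ) ≤ 3), nsmul_eq_mul]
  simp

section

variable {n m : ℕ} [Nonempty (Fin (m + 1) ↪ Fin n)]

lemma volume_codimGap_le (z : Fin n → ℝ) (r : ℝ) :
    volume {t ∈ Icc (0 : Fin n → ℝ) 1 | codimGap m (z + t) ≤ r} ≤
      Fintype.card (Fin (m + 1) ↪ Fin n) * ENNReal.ofReal (3 * r) ^ (m + 1) := by
  have hsub : {t ∈ Icc (0 : Fin n → ℝ) 1 | codimGap m (z + t) ≤ r} ⊆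
      ⋃ κ : Fin (m + 1) ↪ Fin n, Set.pi univ fun i =>
        if i ∈ Finset.univ.map κ then {τ ∈ Icc (0 : ℝ) 1 | gridGap (z i + τ) ≤ r} else Icc 0 1 := by
    rintro t ⟨ht, hr⟩
    obtain ⟨κ, hκ⟩ := exists_forall_gridGap_le hr
    refine mem_iUnion.2 ⟨κ, fun i _ => ?_⟩
    have hti : t i ∈ Icc (0 : ℝ) 1 := ⟨ht.1 i, ht.2 i⟩
    beta_reduce
    split_ifs with hi
    · obtain ⟨a, -, rfl⟩ := Finset.mem_map.1 hi
      exact ⟨hti, hκ a⟩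
    · exact hti
  refine (measure_mono hsub).trans ((measure_iUnion_le _).trans ?_)
  rw [tsum_fintype, ← nsmul_eq_mul, ← Finset.card_univ, ← Finset.sum_const]
  refine Finset.sum_le_sum fun κ _ => ?_
  rw [volume_pi_pi]
  calc ∏ i, volume (if i ∈ Finset.univ.map κ then {τ ∈ Icc (0 : ℝ) 1 | gridGap (z i + τ) ≤ r}
        else Icc 0 1)
      ≤ ∏ i, if i ∈ Finset.univ.map κ then ENNReal.ofReal (3 * r) else 1 := by
        refine Finset.prod_le_prod' fun i _ => ?_
        split_ifs
        · exact volume_gridGap_le _ _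
        · simp
    _ = ENNReal.ofReal (3 * r) ^ (m + 1) := by
        rw [Fintype.prod_ite_mem, Finset.prod_const, Finset.card_map, Finset.card_univ,
          Fintype.card_fin]

lemma ae_codimGap_pos {X : Type*} [MetricSpace X] [MeasurableSpace X] [BorelSpace X]
    {F : Set X} (hF : μH[(m : ℝ) + 1] F = 0) {z : X → Fin n → ℝ} (hz : ∃ K, LipschitzWith K z) :
    ∀ᵐ t : Fin n → ℝ, ∀ x ∈ F, 0 < codimGap m (z x + t) := by
  obtain ⟨K, hK⟩ := hz
  have key : ∀ (κ : Fin (m + 1) ↪ Fin n) (q : Fin (m + 1) → ℤ), ∀ᵐ t : Fin n → ℝ,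
      t ∘ κ ∉ (fun x a => (q a : ℝ) - z x (κ a)) '' F := fun κ q => by
    have hLip : LipschitzWith K fun x a => (q a : ℝ) - z x (κ a) := by
      refine LipschitzWith.of_dist_le_mul fun x y => (dist_pi_le_iff (by positivity)).2 fun a => ?_
      rw [dist_sub_left]
      exact (dist_le_pi_dist (z x) (z y) (κ a)).trans (hK.dist_le_mul x y)
    have hnull : volume ((fun x a => (q a : ℝ) - z x (κ a)) '' F) = 0 := by
      have h := volume_image_le_hausdorffMeasure (m := m + 1) (hLip.lipschitzOnWith (s := F))
      rw [Nat.cast_add, Nat.cast_one, hF, mul_zero] at h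
      exact le_antisymm h bot_le
    have h := (ae_comp_linearMap_mem_iff (LinearMap.funLeft ℝ ℝ κ) volume volume
      (LinearMap.funLeft_surjective_of_injective ℝ ℝ κ κ.injective)
      (measurableSet_toMeasurable volume _).compl).2
      (measure_eq_zero_iff_ae_notMem.1 ((measure_toMeasurable _).trans hnull))
    filter_upwards [h] with t ht hmem using ht (subset_toMeasurable _ _ hmem)
  filter_upwards [ae_all_iff.2 fun κ => ae_all_iff.2 (key κ)] with t ht x hx
  by_contra! hle
  obtain ⟨κ, hκ⟩ := exists_forall_gridGap_le hle
  refine ht κ (fun a => round ((z x + t) (κ a))) ⟨x, hx, funext fun a => ?_⟩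
  have h0 : |(z x + t) (κ a) - round ((z x + t) (κ a))| = 0 := by
    have := hκ a
    unfold gridGap at this
    exact le_antisymm (by linarith) (abs_nonneg _)
  have h1 := abs_eq_zero.1 h0
  rw [Pi.add_apply] at h1
  simp only [Function.comp_apply, Pi.add_apply]
  linarith

variable {X : Type*} [TopologicalSpace X] [SecondCountableTopology X] [MeasurableSpace X]
  [BorelSpace X]

lemma measurableSet_codimGap_le {z : X → Fin n → ℝ} (hz : Continuous z) (r : ℝ) :
    MeasurableSet {w : (Fin n → ℝ) × X | codimGap m (z w.2 + w.1) ≤ r} :=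
  (isClosed_le (continuous_codimGap.comp (by fun_prop)) continuous_const).measurableSet

lemma lintegral_measure_codimGap_le (μ : Measure X) [IsFiniteMeasure μ] {z : X → Fin n → ℝ}
    (hz : Continuous z) (r : ℝ) :
    ∫⁻ t in Icc (0 : Fin n → ℝ) 1, μ {x | codimGap m (z x + t) ≤ r} ≤
      Fintype.card (Fin (m + 1) ↪ Fin n) * ENNReal.ofReal (3 * r) ^ (m + 1) * μ univ := by
  have hmeas := measurableSet_codimGap_le (m := m) hz r
  have h1 := Measure.prod_apply (μ := volume.restrict (Icc (0 : Fin n → ℝ) 1)) (ν := μ) hmeas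
  have h2 := Measure.prod_apply_symm (μ := volume.restrict (Icc (0 : Fin n → ℝ) 1)) (ν := μ) hmeas
  have h3 : ∫⁻ t in Icc (0 : Fin n → ℝ) 1, μ {x | codimGap m (z x + t) ≤ r} =
      ∫⁻ x, (volume.restrict (Icc (0 : Fin n → ℝ) 1)) {t | codimGap m (z x + t) ≤ r} ∂μ :=
    h1.symm.trans h2
  rw [h3, ← lintegral_const]
  refine lintegral_mono fun x => ?_
  have hm : MeasurableSet {t | codimGap m (z x + t) ≤ r} := measurable_prodMk_right hmeas
  rw [Measure.restrict_apply hm, inter_comm]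
  exact volume_codimGap_le (z x) r

/-- The total weighted measure of the dyadic sublevel sets of `codimGap`. -/
def gapWeight (m : ℕ) [Nonempty (Fin (m + 1) ↪ Fin n)] (μ : Measure X) (z : X → Fin n → ℝ) (C : ℝ)
    (t : Fin n → ℝ) : ℝ≥0∞ :=
  ∑' k : ℕ, ENNReal.ofReal ((C * 2 ^ (k + 1)) ^ m) * μ {x | codimGap m (z x + t) ≤ (1 / 2) ^ k}

lemma exists_gapWeight_const (n m : ℕ) [Nonempty (Fin (m + 1) ↪ Fin n)] {C : ℝ} (hC : 0 ≤ C) :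
    ∃ D : ℝ≥0∞, D ≠ ⊤ ∧ ∀ {X : Type} [TopologicalSpace X] [SecondCountableTopology X]
      [MeasurableSpace X] [BorelSpace X] (μ : Measure X) [IsFiniteMeasure μ] (z : X → Fin n → ℝ)
      (_ : Continuous z) (p : (Fin n → ℝ) → Prop) (_ : ∀ᵐ t, p t),
      ∃ t, p t ∧ gapWeight m μ z C t ≤ D * μ univ := by
  have hterm : ∀ k : ℕ, ENNReal.ofReal ((C * 2 ^ (k + 1)) ^ m) *
      ENNReal.ofReal (3 * (1 / 2) ^ k) ^ (m + 1) =
      ENNReal.ofReal ((2 * C) ^ m * 3 ^ (m + 1) * (1 / 2) ^ k) := fun k => by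
    rw [← ENNReal.ofReal_pow (by positivity), ← ENNReal.ofReal_mul (by positivity)]
    congr 1
    have h2 : ((2 : ℝ) ^ k) ^ m * (((1 / 2 : ℝ)) ^ k) ^ m = 1 := by
      rw [← mul_pow, ← mul_pow]; norm_num
    calc (C * 2 ^ (k + 1)) ^ m * (3 * (1 / 2) ^ k) ^ (m + 1)
        = (2 * C) ^ m * 3 ^ (m + 1) * (1 / 2) ^ k * (((2 : ℝ) ^ k) ^ m * (((1 / 2 : ℝ)) ^ k) ^ m) := by
          rw [pow_succ (2 : ℝ) k, mul_pow 3, pow_succ ((1 / 2 : ℝ) ^ k) m, mul_pow C, mul_pow _ 2,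
            mul_pow 2 C]
          ring
      _ = _ := by rw [h2, mul_one]
  refine ⟨Fintype.card (Fin (m + 1) ↪ Fin n) *
    ∑' k : ℕ, ENNReal.ofReal ((2 * C) ^ m * 3 ^ (m + 1) * (1 / 2) ^ k), ?_, ?_⟩
  · refine ENNReal.mul_ne_top (by finiteness) (Summable.tsum_ofReal_ne_top ?_)
    exact (summable_geometric_of_lt_one (by norm_num) (by norm_num)).mul_left _
  · intro X _ _ _ _ μ _ z hz p hp
    have hmeas : ∀ k : ℕ, Measurable fun t => μ {x | codimGap m (z x + t) ≤ (1 / 2) ^ k} :=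
      fun k => measurable_measure_prodMk_left (measurableSet_codimGap_le hz _)
    have hprob : IsProbabilityMeasure (volume.restrict (Icc (0 : Fin n → ℝ) 1)) := ⟨by
      rw [Measure.restrict_apply_univ, Real.volume_Icc_pi]
      simp⟩
    obtain ⟨t, ht, hle⟩ := exists_notMem_null_le_lintegral
      (μ := volume.restrict (Icc (0 : Fin n → ℝ) 1)) (f := gapWeight m μ z C)
      (Measurable.tsum fun k => (hmeas k).const_mul _).aemeasurable
      (ae_iff.1 (ae_restrict_of_ae hp))
    refine ⟨t, not_not.1 ht, hle.trans ?_⟩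
    unfold gapWeight
    rw [lintegral_tsum fun k => ((hmeas k).const_mul _).aemeasurable, ← ENNReal.tsum_mul_left,
      ← ENNReal.tsum_mul_right]
    refine ENNReal.tsum_le_tsum fun k => ?_
    rw [lintegral_const_mul _ (hmeas k), ← hterm k]
    calc _ ≤ ENNReal.ofReal ((C * 2 ^ (k + 1)) ^ m) * (Fintype.card (Fin (m + 1) ↪ Fin n) *
          ENNReal.ofReal (3 * (1 / 2) ^ k) ^ (m + 1) * μ univ) := by
          gcongr
          exact lintegral_measure_codimGap_le μ hz _
      _ = _ := by ring

end

section

variable {n m : ℕ}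

/-- The map on the `m` slots `ι` given by truncated dilation about `q`, constant on the other
coordinates. -/
def slotMap (q v : Fin n → ℤ) (e : ℤ) (ι : Fin m → Fin n) (p : Fin m → ℝ) (i : Fin n) : ℝ :=
  q i + Function.extend ι (fun a => clampHalf (e * p a / 2)) (fun i => v i / 2) i

lemma exists_lipschitzWith_slotMap (q v : Fin n → ℤ) (e : ℤ) {ι : Fin m → Fin n}
    (hι : Function.Injective ι) : ∃ K, LipschitzWith K (slotMap q v e ι) := by
  refine ⟨Real.nnabs (e / 2), LipschitzWith.of_dist_le_mul fun p p' =>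
    (dist_pi_le_iff (by positivity)).2 fun i => ?_⟩
  unfold slotMap
  rw [dist_add_left]
  by_cases hi : ∃ a, ι a = i
  · obtain ⟨a, rfl⟩ := hi
    rw [hι.extend_apply, hι.extend_apply, Real.dist_eq]
    refine (abs_clampHalf_sub_le _ _).trans ?_
    have h : (e : ℝ) * p a / 2 - e * p' a / 2 = e / 2 * (p a - p' a) := by ring
    rw [h, abs_mul, Real.coe_nnabs, ← Real.dist_eq]
    gcongr
    exact dist_le_pi_dist p p' a
  · rw [Function.extend_apply' _ _ _ hi, Function.extend_apply' _ _ _ hi, dist_self]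
    positivity

lemma hausdorffMeasure_slotMap_image_eq_zero (q v : Fin n → ℤ) (e : ℤ) {ι : Fin m → Fin n}
    (hι : Function.Injective ι) {P : Set (Fin m → ℝ)} (hP : volume P = 0) :
    μH[m] (slotMap q v e ι '' P) = 0 := by
  obtain ⟨K, hK⟩ := exists_lipschitzWith_slotMap q v e hι
  have h := hK.hausdorffMeasure_image_le (d := (m : ℝ)) (by positivity) P
  have hvol : (μH[m] : Measure (Fin m → ℝ)) = volume := by
    simpa using hausdorffMeasure_pi_real (ι := Fin m)
  rw [hvol, hP, mul_zero] at h
  exact le_antisymm h bot_le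

variable [Nonempty (Fin (m + 1) ↪ Fin n)]

/-- Pushing by `codimGap` lands in a countable union of slot maps of projective images. -/
lemma exists_slotMap_eq_cellPush (z : Fin n → ℝ) (hz : 0 < codimGap m z) :
    ∃ (k : Fin n) (ι : Fin m → Fin n) (e : ℤ) (v : Fin n → ℤ), Function.Injective ι ∧
      k ∉ range ι ∧ codimGap m z = 2 * |z k - round (z k)| ∧
      (fun i => cellPush (codimGap m z) (z i)) = slotMap (fun i => round (z i)) v e ι
        (fun a => (z (ι a) - round (z (ι a))) / (z k - round (z k))) := by
  obtain ⟨k, ι, hι, hk, hgap, hle⟩ := exists_injective_slots (m := m) z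
  unfold gridGap at hgap hle
  refine ⟨k, ι, if 0 ≤ z k - round (z k) then 1 else -1,
    fun i => if 0 ≤ z i - round (z i) then 1 else -1, hι, hk, hgap.symm, funext fun i => ?_⟩
  unfold cellPush slotMap
  congr 1
  by_cases hi : ∃ a, ι a = i
  · obtain ⟨a, rfl⟩ := hi
    rw [hι.extend_apply, ← hgap]
    congr 1
    rcases abs_cases (z k - round (z k)) with ⟨h1, h2⟩ | ⟨h1, h2⟩
    · rw [if_pos h2, h1]
      push_cast
      rw [one_mul, div_div, mul_comm]
    · rw [if_neg h2.not_ge, h1]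
      push_cast
      rw [neg_one_mul, mul_neg, div_neg, neg_div, div_div, mul_comm]
  · rw [Function.extend_apply' _ _ _ hi]
    beta_reduce
    have h := hle i hi
    rcases abs_cases (z i - round (z i)) with ⟨h1, h2⟩ | ⟨h1, h2⟩
    · rw [if_pos h2]
      rw [h1] at h
      push_cast
      exact clampHalf_of_le (by rw [le_div_iff₀ hz]; linarith)
    · rw [if_neg h2.not_ge]
      rw [h1] at h
      push_cast
      exact clampHalf_of_le_neg (by rw [div_le_iff₀ hz]; linarith)

lemma hausdorffMeasure_cellPush_image_eq_zero {A : Set (Fin n → ℝ)} {T : Matrix (Fin n) (Fin n) ℝ}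
    {t : Fin n → ℝ} (hgen : ∀ (q : Fin n → ℤ) (k) (ι : Fin m → Fin n), Function.Injective ι →
      k ∉ range ι → ∀ i : ℕ,
        volume (projectiveImage A k ι (1 / (i + 1 : ℝ)) T (fun r => t r - q r)) = 0)
    {σ : ℝ} (hσ : 0 < σ) (hA : ∀ x ∈ A, σ ≤ codimGap m (T.mulVec x + t)) :
    μH[m] ((fun x i => cellPush (codimGap m (T.mulVec x + t)) ((T.mulVec x + t) i)) '' A) = 0 := by
  obtain ⟨j, hj⟩ := exists_nat_one_div_lt (half_pos hσ)
  refine measure_mono_null (t := ⋃ (q : Fin n → ℤ) (k : Fin n) (ι : Fin m → Fin n) (e : ℤ)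
    (v : Fin n → ℤ) (_ : Function.Injective ι ∧ k ∉ range ι), slotMap q v e ι ''
      projectiveImage A k ι (1 / (j + 1 : ℝ)) T (fun r => t r - q r)) ?_ ?_
  · rintro _ ⟨x, hx, rfl⟩
    obtain ⟨k, ι, e, v, hι, hk, hgap, heq⟩ :=
      exists_slotMap_eq_cellPush (m := m) (T.mulVec x + t) (hσ.trans_le (hA x hx))
    simp only [mem_iUnion]
    refine ⟨_, k, ι, e, v, ⟨hι, hk⟩, _, ⟨x, hx, ?_, fun a => ?_⟩, heq.symm⟩
    · have h1 := hA x hx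
      rw [hgap] at h1
      have h2 : T k ⬝ᵥ x + (t k - round ((T.mulVec x + t) k)) =
          (T.mulVec x + t) k - round ((T.mulVec x + t) k) := by
        rw [Pi.add_apply, Matrix.mulVec]; ring
      rw [h2]
      linarith
    · have h2 : ∀ i, T i ⬝ᵥ x + (t i - round ((T.mulVec x + t) i)) =
          (T.mulVec x + t) i - round ((T.mulVec x + t) i) := fun i => by
        rw [Pi.add_apply, Matrix.mulVec]; ring
      rw [h2, h2]
      refine div_mul_cancel₀ _ fun h0 => ?_
      have h1 := hA x hx
      rw [hgap, h0, abs_zero] at h1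
      linarith
  · simp only [measure_iUnion_null_iff]
    exact fun q k ι e v h => hausdorffMeasure_slotMap_image_eq_zero q v e h.1 (hgen q k ι h.1 h.2 j)

lemma hausdorffMeasure_image_le_gapWeight {X Y : Type*} [MetricSpace X] [SecondCountableTopology X]
    [MeasurableSpace X] [BorelSpace X] [MetricSpace Y] [MeasurableSpace Y] [BorelSpace Y]
    {R : Set X} {z : X → Fin n → ℝ} {t : Fin n → ℝ} {C : ℝ} (hC : 0 ≤ C) {ψ : X → Y}
    (hpos : ∀ x ∈ R, 0 < codimGap m (z x + t))
    (hψ : ∀ σ > 0, ∀ x y, σ ≤ codimGap m (z x + t) → σ ≤ codimGap m (z y + t) →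
      dist (ψ x) (ψ y) ≤ C / σ * dist x y) :
    μH[m] (ψ '' R) ≤ gapWeight m (μH[m].restrict R) z C t := by
  have hsub : ψ '' R ⊆ ⋃ k : ℕ, ψ '' {x ∈ R | (1 / 2) ^ (k + 1) < codimGap m (z x + t) ∧
      codimGap m (z x + t) ≤ (1 / 2) ^ k} := by
    rintro _ ⟨x, hx, rfl⟩
    obtain ⟨k, hk, hk'⟩ := exists_nat_pow_near_of_lt_one (hpos x hx) (codimGap_le_one _)
      (by norm_num : (0 : ℝ) < 1 / 2) (by norm_num)
    exact mem_iUnion.2 ⟨k, x, ⟨hx, hk, hk'⟩, rfl⟩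
  refine (measure_mono hsub).trans ((measure_iUnion_le _).trans (ENNReal.tsum_le_tsum fun k => ?_))
  have hLip : LipschitzOnWith (C * 2 ^ (k + 1)).toNNReal ψ
      {x ∈ R | (1 / 2) ^ (k + 1) < codimGap m (z x + t) ∧ codimGap m (z x + t) ≤ (1 / 2) ^ k} :=
    LipschitzOnWith.of_dist_le_mul fun x hx y hy => by
      rw [Real.coe_toNNReal _ (by positivity)]
      refine (hψ ((1 / 2) ^ (k + 1)) (by positivity) x y hx.2.1.le hy.2.1.le).trans (le_of_eq ?_)
      rw [one_div, inv_pow, div_inv_eq_mul]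
  refine (hLip.hausdorffMeasure_image_le (Nat.cast_nonneg m)).trans ?_
  rw [ENNReal.rpow_natCast, ← ENNReal.ofReal, ← ENNReal.ofReal_pow (by positivity)]
  refine mul_le_mul' le_rfl (le_trans (measure_mono ?_) (Measure.le_restrict_apply _ _))
  exact fun x hx => ⟨hx.2.2, hx.1⟩

end

section

variable {n m : ℕ}

lemma exists_dist_mulVec_le (T : Matrix (Fin n) (Fin n) ℝ) :
    ∃ A : ℝ, 0 ≤ A ∧ ∀ x y : Fin n → ℝ, dist (T.mulVec x) (T.mulVec y) ≤ A * dist x y :=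
  ⟨_, norm_nonneg T.mulVecLin.toContinuousLinearMap, fun x y => by
    simpa using T.mulVecLin.toContinuousLinearMap.lipschitz.dist_le_mul x y⟩

/-- In the coordinates `z = N • T x + t`, push each coordinate in its unit cell with scale `s x`. -/
def gridDeform (T : Matrix (Fin n) (Fin n) ℝ) (N : ℝ) (t : Fin n → ℝ) (s : (Fin n → ℝ) → ℝ)
    (x : Fin n → ℝ) : Fin n → ℝ :=
  T⁻¹.mulVec (N⁻¹ • ((fun i => cellPush (s x) (((N • T).mulVec x + t) i)) - t))

variable {T : Matrix (Fin n) (Fin n) ℝ} {N : ℝ} {t : Fin n → ℝ} {s : (Fin n → ℝ) → ℝ}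

lemma inv_mulVec_smul_add_sub (hT : T.det ≠ 0) (hN : N ≠ 0) (x : Fin n → ℝ) :
    T⁻¹.mulVec (N⁻¹ • (((N • T).mulVec x + t) - t)) = x := by
  rw [add_sub_cancel_right, Matrix.smul_mulVec, inv_smul_smul₀ hN, Matrix.mulVec_mulVec,
    Matrix.nonsing_inv_mul _ (isUnit_iff_ne_zero.2 hT), Matrix.one_mulVec]

lemma gridDeform_of_eq_one (hT : T.det ≠ 0) (hN : N ≠ 0) {x : Fin n → ℝ} (hx : s x = 1) :
    gridDeform T N t s x = x := by
  unfold gridDeform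
  simp only [hx, cellPush_one]
  exact inv_mulVec_smul_add_sub hT hN x

lemma dist_inv_mulVec_smul_sub_le (hN : 0 < N) {B : ℝ}
    (hB : ∀ x y : Fin n → ℝ, dist (T⁻¹.mulVec x) (T⁻¹.mulVec y) ≤ B * dist x y)
    (a b : Fin n → ℝ) :
    dist (T⁻¹.mulVec (N⁻¹ • (a - t))) (T⁻¹.mulVec (N⁻¹ • (b - t))) ≤ B / N * dist a b := by
  refine (hB _ _).trans (le_of_eq ?_)
  rw [dist_smul₀, dist_sub_right, Real.norm_of_nonneg (inv_nonneg.2 hN.le), ← mul_assoc,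
    div_eq_mul_inv]

lemma dist_gridDeform_le (hT : T.det ≠ 0) (hN : 0 < N) {B : ℝ} (hB0 : 0 ≤ B)
    (hB : ∀ x y : Fin n → ℝ, dist (T⁻¹.mulVec x) (T⁻¹.mulVec y) ≤ B * dist x y) (x : Fin n → ℝ) :
    dist (gridDeform T N t s x) x ≤ B / N := by
  have h := dist_inv_mulVec_smul_sub_le (t := t) hN hB
    (fun i => cellPush (s x) (((N • T).mulVec x + t) i)) ((N • T).mulVec x + t)
  rw [inv_mulVec_smul_add_sub hT hN.ne' x] at h
  refine h.trans ?_
  refine mul_le_of_le_one_right (by positivity) ((dist_pi_le_iff zero_le_one).2 fun i => ?_)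
  exact abs_cellPush_sub_le _ _

lemma dist_mulVec_smul_add_le (hN : 0 < N) {A : ℝ}
    (hA : ∀ x y : Fin n → ℝ, dist (T.mulVec x) (T.mulVec y) ≤ A * dist x y) (x y : Fin n → ℝ) :
    dist ((N • T).mulVec x + t) ((N • T).mulVec y + t) ≤ N * A * dist x y := by
  rw [dist_add_right, Matrix.smul_mulVec, Matrix.smul_mulVec, dist_smul₀,
    Real.norm_of_nonneg hN.le, mul_assoc]
  gcongr
  exact hA x y

lemma dist_gridDeform_gridDeform_le (hN : 0 < N) {A B σ : ℝ} (hB0 : 0 ≤ B)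
    (hA : ∀ x y : Fin n → ℝ, dist (T.mulVec x) (T.mulVec y) ≤ A * dist x y)
    (hB : ∀ x y : Fin n → ℝ, dist (T⁻¹.mulVec x) (T⁻¹.mulVec y) ≤ B * dist x y)
    (hs : ∀ x y, |s x - s y| ≤ N * (2 * A + 1) * dist x y) (hs1 : ∀ x, s x ≤ 1) (hσ : 0 < σ)
    {x y : Fin n → ℝ} (hx : σ ≤ s x) (hy : σ ≤ s y) :
    dist (gridDeform T N t s x) (gridDeform T N t s y) ≤ B * (2 * A + 1) / σ * dist x y := by
  have hz := dist_mulVec_smul_add_le (t := t) hN hA x y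
  have hd : (0 : ℝ) ≤ N * dist x y := by positivity
  have hpush : dist (fun i => cellPush (s x) (((N • T).mulVec x + t) i))
      (fun i => cellPush (s y) (((N • T).mulVec y + t) i)) ≤
      N * (2 * A + 1) * dist x y / σ := by
    refine (dist_pi_le_iff ?_).2 fun i => ?_
    · exact div_nonneg ((abs_nonneg _).trans (hs x y)) hσ.le
    · rw [Real.dist_eq]
      refine (abs_cellPush_sub_cellPush_le_add hσ hx (hs1 x) hy _ _).trans ?_
      have h1 := (dist_le_pi_dist ((N • T).mulVec x + t) ((N • T).mulVec y + t) i).trans hz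
      rw [Real.dist_eq] at h1
      have h2 := hs x y
      gcongr
      nlinarith
  refine (dist_inv_mulVec_smul_sub_le hN hB _ _).trans
    ((mul_le_mul_of_nonneg_left hpush (by positivity)).trans (le_of_eq ?_))
  field_simp

/-- The scale used for pushing: `codimGap` near `K`, interpolated to `1` at distance `ρ`. -/
def pushScale (m : ℕ) [Nonempty (Fin (m + 1) ↪ Fin n)] (T : Matrix (Fin n) (Fin n) ℝ) (N : ℝ)
    (t : Fin n → ℝ) (K : Set (Fin n → ℝ)) (ρ σ : ℝ) (x : Fin n → ℝ) : ℝ :=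
  max (codimGap m ((N • T).mulVec x + t)) (max (min 1 (infDist x K / ρ)) σ)

variable [Nonempty (Fin (m + 1) ↪ Fin n)] {K : Set (Fin n → ℝ)} {ρ σ : ℝ}

lemma pushScale_le_one (hσ : σ ≤ 1) (x : Fin n → ℝ) : pushScale m T N t K ρ σ x ≤ 1 :=
  max_le (codimGap_le_one _) (max_le (min_le_left _ _) hσ)

lemma abs_pushScale_sub_le {A : ℝ} (hN : 0 < N) (hρ : 0 < ρ) (hρN : 1 / ρ ≤ N) (hA0 : 0 ≤ A)
    (hA : ∀ x y : Fin n → ℝ, dist (T.mulVec x) (T.mulVec y) ≤ A * dist x y) (x y : Fin n → ℝ) :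
    |pushScale m T N t K ρ σ x - pushScale m T N t K ρ σ y| ≤ N * (2 * A + 1) * dist x y := by
  have hd : (0 : ℝ) ≤ N * dist x y := by positivity
  have hAd : (0 : ℝ) ≤ A * (N * dist x y) := by positivity
  refine (abs_max_sub_max_le_max _ _ _ _).trans (max_le ?_ ?_)
  · refine (abs_codimGap_sub_le _ _).trans ?_
    have := dist_mulVec_smul_add_le (t := t) hN hA x y
    linarith
  · refine (abs_max_sub_max_le_max _ _ _ _).trans (max_le ?_ ?_)
    · refine (abs_min_sub_min_le_max _ _ _ _).trans (max_le ?_ ?_)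
      · rw [sub_self, abs_zero]
        linarith
      · have h := (lipschitz_infDist_pt K).dist_le_mul x y
        rw [NNReal.coe_one, one_mul, Real.dist_eq] at h
        rw [← sub_div, abs_div, abs_of_pos hρ, div_eq_mul_one_div]
        have := mul_le_mul h hρN (by positivity) dist_nonneg
        linarith
    · rw [sub_self, abs_zero]
      linarith

/-- A compact purely unrectifiable set can be squeezed to a null set by a small deformation that is
supported near it and controls the measure of the image of any given set. -/
theorem exists_grid_deformation {F : Set (Fin n → ℝ)} (hK : IsCompact K) (hKne : K.Nonempty)
    (hKF : K ⊆ F) (hF : μH[(m : ℝ) + 1] F = 0) (hfin : μH[m] K ≠ ⊤)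
    (hpu : ∀ g : (Fin m → ℝ) → Fin n → ℝ, (∃ L, LipschitzWith L g) → μH[m] (K ∩ range g) = 0) :
    ∃ C : ℝ≥0∞, C ≠ ⊤ ∧ ∀ ρ > 0, ∀ ε > 0, ∀ R ⊆ F, μH[m] R ≠ ⊤ →
      ∃ ψ : (Fin n → ℝ) → Fin n → ℝ, (∃ L, LipschitzWith L ψ) ∧ (∀ x, dist (ψ x) x < ε) ∧
        (∀ x ∉ thickening ρ K, ψ x = x) ∧ μH[m] (ψ '' K) = 0 ∧ μH[m] (ψ '' R) ≤ C * μH[m] R := by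
  obtain ⟨T, hT, hgen⟩ := exists_linear_generic hK hfin hpu
  obtain ⟨A, hA0, hA⟩ := exists_dist_mulVec_le T
  obtain ⟨B, hB0, hB⟩ := exists_dist_mulVec_le T⁻¹
  obtain ⟨C, hC, hweight⟩ := exists_gapWeight_const n m (C := B * (2 * A + 1)) (by positivity)
  refine ⟨C, hC, fun ρ hρ ε hε R hRF hR => ?_⟩
  obtain ⟨N, hN⟩ := exists_nat_gt (max (1 / ρ) (B / ε))
  have hρN : 1 / ρ ≤ N := ((le_max_left _ _).trans_lt hN).le
  have hN0 : (0 : ℝ) < N := (by positivity : 0 < 1 / ρ).trans_le hρN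
  have hBN : B / N < ε := by
    have := (le_max_right _ _).trans_lt hN
    rw [div_lt_iff₀ hε] at this
    rw [div_lt_iff₀ hN0]
    linarith
  have hzLip : LipschitzWith (N * A).toNNReal fun x => ((N : ℝ) • T).mulVec x :=
    LipschitzWith.of_dist_le_mul fun x y => by
      rw [Real.coe_toNNReal _ (by positivity)]
      simpa using dist_mulVec_smul_add_le (t := 0) hN0 hA x y
  have : IsFiniteMeasure ((μH[m] : Measure (Fin n → ℝ)).restrict R) :=
    ⟨by rw [Measure.restrict_apply_univ]; exact hR.lt_top⟩
  obtain ⟨t, ⟨hproj, hpos⟩, hle⟩ := hweight (μH[m].restrict R) (fun x => ((N : ℝ) • T).mulVec x)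
    hzLip.continuous _ ((hgen N (by exact_mod_cast hN0.ne')).and (ae_codimGap_pos hF ⟨_, hzLip⟩))
  rw [Measure.restrict_apply_univ] at hle
  obtain ⟨σ', hσ', hσ'K⟩ := hK.exists_forall_le' (f := fun x => codimGap m (((N : ℝ) • T).mulVec x + t))
    (continuous_codimGap.comp (hzLip.continuous.add continuous_const)).continuousOn
    fun x hx => hpos x (hKF hx)
  set σ := min σ' 1
  have hσ : 0 < σ := lt_min hσ' one_pos
  set s := pushScale m T N t K ρ σ
  have hs := abs_pushScale_sub_le (m := m) (t := t) (K := K) (σ := σ) hN0 hρ hρN hA0 hA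
  have hs1 : ∀ x, s x ≤ 1 := pushScale_le_one (min_le_right _ _)
  have hsσ : ∀ x, σ ≤ s x := fun x => (le_max_right _ _).trans (le_max_right _ _)
  refine ⟨gridDeform T N t s, ⟨(B * (2 * A + 1) / σ).toNNReal, ?_⟩, fun x => ?_, fun x hx => ?_,
    ?_, ?_⟩
  · refine LipschitzWith.of_dist_le_mul fun x y => ?_
    rw [Real.coe_toNNReal _ (by positivity)]
    exact dist_gridDeform_gridDeform_le hN0 hB0 hA hB hs hs1 hσ (hsσ x) (hsσ y)
  · exact (dist_gridDeform_le hT hN0 hB0 hB x).trans_lt hBN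
  · refine gridDeform_of_eq_one hT hN0.ne' (le_antisymm (hs1 x) ?_)
    rw [mem_thickening_iff_infDist_lt hKne, not_lt] at hx
    refine le_trans ?_ ((le_max_left _ _).trans (le_max_right _ _))
    exact le_min le_rfl ((one_le_div hρ).2 hx)
  · have hnull := hausdorffMeasure_cellPush_image_eq_zero hproj hσ
      fun x hx => (min_le_left _ _).trans (hσ'K x hx)
    have hW : LipschitzWith (B / N).toNNReal fun y => T⁻¹.mulVec ((N : ℝ)⁻¹ • (y - t)) :=
      LipschitzWith.of_dist_le_mul fun x y => by
        rw [Real.coe_toNNReal _ (by positivity)]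
        exact dist_inv_mulVec_smul_sub_le hN0 hB x y
    have h := hW.hausdorffMeasure_image_le (d := (m : ℝ)) (by positivity)
      ((fun x i => cellPush (codimGap m (((N : ℝ) • T).mulVec x + t))
        ((((N : ℝ) • T).mulVec x + t) i)) '' K)
    rw [hnull, mul_zero, image_image] at h
    refine le_antisymm (le_trans (le_of_eq (congrArg _ (image_congr fun x hx => ?_))) h) bot_le
    have hsx : s x = codimGap m (((N : ℝ) • T).mulVec x + t) := by
      refine max_eq_left (max_le ?_ ((min_le_left _ _).trans (hσ'K x hx)))
      rw [infDist_zero_of_mem hx, zero_div]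
      exact (min_le_right _ _).trans (codimGap_nonneg _)
    rw [gridDeform, hsx]
  · refine (hausdorffMeasure_image_le_gapWeight (by positivity) (fun x hx => hpos x (hRF hx))
      fun σ' hσ' x y hx hy => ?_).trans hle
    exact dist_gridDeform_gridDeform_le hN0 hB0 hA hB hs hs1 hσ' (hx.trans (le_max_left _ _))
      (hy.trans (le_max_left _ _))

end

section

variable {n m : ℕ}

lemma isRectifiable_range {f : En m → En n} (hf : ∃ L, LipschitzWith L f) :
    IsRectifiable n m (range f) :=
  ⟨fun _ => f, fun _ => hf, by simp [iUnion_const]⟩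

lemma isRectifiable_univ_of_le (h : n ≤ m) : IsRectifiable n m univ := by
  let f : En m →ₗ[ℝ] En n := (EuclideanSpace.equiv (Fin n) ℝ).symm.toLinearMap ∘ₗ
    LinearMap.funLeft ℝ ℝ (Fin.castLE h) ∘ₗ (EuclideanSpace.equiv (Fin m) ℝ).toLinearMap
  have hsurj : Function.Surjective f :=
    (EuclideanSpace.equiv (Fin n) ℝ).symm.surjective.comp
      ((LinearMap.funLeft_surjective_of_injective ℝ ℝ _ (Fin.castLE_injective h)).comp
        (EuclideanSpace.equiv (Fin m) ℝ).surjective)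
  rw [← hsurj.range_eq]
  exact isRectifiable_range ⟨_, f.toContinuousLinearMap.lipschitz⟩

lemma hausdorffMeasure_image_eq_zero {X Y : Type*} [EMetricSpace X] [MeasurableSpace X]
    [BorelSpace X] [EMetricSpace Y] [MeasurableSpace Y] [BorelSpace Y] {f : X → Y} {L : NNReal}
    (hf : LipschitzWith L f) {d : ℝ} (hd : 0 ≤ d) {s : Set X} (hs : μH[d] s = 0) :
    μH[d] (f '' s) = 0 := by
  have h := hf.hausdorffMeasure_image_le hd s
  rw [hs, mul_zero] at h
  exact le_antisymm h bot_le

lemma PurelyUnrectifiable.hausdorffMeasure_inter_range_eq_zero {U : Set (En n)}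
    (hU : PurelyUnrectifiable n m U) {g : (Fin m → ℝ) → Fin n → ℝ} (hg : ∃ L, LipschitzWith L g) :
    μH[m] (EuclideanSpace.equiv (Fin n) ℝ '' U ∩ range g) = 0 := by
  obtain ⟨L, hL⟩ := hg
  let e := EuclideanSpace.equiv (Fin n) ℝ
  let e' := EuclideanSpace.equiv (Fin m) ℝ
  have h := hU (range (e.symm ∘ g ∘ e')) (isRectifiable_range
    ⟨_, e.symm.lipschitz.comp (hL.comp e'.lipschitz)⟩)
  refine measure_mono_null ?_ (hausdorffMeasure_image_eq_zero e.lipschitz (Nat.cast_nonneg m) h)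
  rintro _ ⟨⟨x, hx, rfl⟩, y, hy⟩
  refine ⟨x, ⟨hx, e'.symm y, ?_⟩, rfl⟩
  simp only [Function.comp_apply, e'.apply_symm_apply, hy]
  exact e.symm_apply_apply x

/-- A compact purely unrectifiable set can be squeezed to a null set by a small deformation that is
supported in a given neighbourhood and controls the measure of the image of any given set. -/
theorem PurelyUnrectifiable.exists_deformation (hmn : m < n) {K F : Set (En n)}
    (hpu : PurelyUnrectifiable n m K) (hK : IsCompact K) (hKne : K.Nonempty) (hKF : K ⊆ F)
    (hF : μH[(m : ℝ) + 1] F = 0) (hfin : μH[m] K ≠ ⊤) :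
    ∃ C : ℝ≥0∞, C ≠ ⊤ ∧ ∀ V, IsOpen V → K ⊆ V → ∀ ε > 0, ∀ R ⊆ F, μH[m] R ≠ ⊤ →
      ∃ ψ : En n → En n, (∃ L, LipschitzWith L ψ) ∧ (∀ x, dist (ψ x) x < ε) ∧
        (∀ x ∉ V, ψ x = x) ∧ μH[m] (ψ '' K) = 0 ∧ μH[m] (ψ '' R) ≤ C * μH[m] R := by
  have : Nonempty (Fin (m + 1) ↪ Fin n) := ⟨Fin.castLEEmb hmn⟩
  let e := EuclideanSpace.equiv (Fin n) ℝ
  have hm : (0 : ℝ) ≤ m := Nat.cast_nonneg m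
  have hne_top : ∀ {s : Set (En n)}, μH[m] s ≠ ⊤ → μH[m] (e '' s) ≠ ⊤ := fun hs =>
    ne_top_of_le_ne_top (ENNReal.mul_ne_top (by finiteness) hs)
      (e.lipschitz.hausdorffMeasure_image_le hm _)
  obtain ⟨C, hC, hdef⟩ := exists_grid_deformation (m := m) (hK.image e.continuous) (hKne.image e)
    (image_mono hKF) (hausdorffMeasure_image_eq_zero e.lipschitz (by positivity) hF) (hne_top hfin)
    fun g hg => hpu.hausdorffMeasure_inter_range_eq_zero hg
  set a := ‖(e : En n →L[ℝ] Fin n → ℝ)‖₊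
  set b := ‖(e.symm : (Fin n → ℝ) →L[ℝ] En n)‖₊
  refine ⟨b ^ (m : ℝ) * (C * a ^ (m : ℝ)), by finiteness, fun V hV hKV ε hε R hRF hR => ?_⟩
  obtain ⟨ρ, hρ, hρV⟩ := (hK.image e.continuous).exists_thickening_subset_open
    (e.toHomeomorph.isOpenMap V hV) (image_mono hKV)
  obtain ⟨ψ, ⟨L, hL⟩, hdist, hid, hnull, hle⟩ := hdef ρ hρ (ε / (b + 1)) (by positivity) (e '' R)
    (image_mono hRF) (hne_top hR)
  have himage : ∀ s, (e.symm ∘ ψ ∘ e) '' s = e.symm '' (ψ '' (e '' s)) := fun s => by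
    simp only [image_comp]
  refine ⟨e.symm ∘ ψ ∘ e, ⟨_, e.symm.lipschitz.comp (hL.comp e.lipschitz)⟩, fun x => ?_,
    fun x hx => ?_, ?_, ?_⟩
  · have h := e.symm.lipschitz.dist_le_mul (ψ (e x)) (e x)
    rw [e.symm_apply_apply] at h
    have h2 := hdist (e x)
    rw [lt_div_iff₀ (by positivity)] at h2
    have h3 : (b : ℝ) * dist (ψ (e x)) (e x) ≤ dist (ψ (e x)) (e x) * (b + 1) := by
      have := dist_nonneg (x := ψ (e x)) (y := e x)
      linarith
    exact (h.trans h3).trans_lt h2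
  · have hex : e x ∉ thickening ρ (e '' K) := fun h => hx (e.injective.mem_set_image.1 (hρV h))
    simp only [Function.comp_apply, hid _ hex, e.symm_apply_apply]
  · rw [himage]
    exact hausdorffMeasure_image_eq_zero e.symm.lipschitz hm hnull
  · rw [himage, mul_assoc, mul_assoc]
    refine (e.symm.lipschitz.hausdorffMeasure_image_le hm _).trans ?_
    gcongr
    refine hle.trans ?_
    gcongr
    exact e.lipschitz.hausdorffMeasure_image_le hm _

end

theorem stmt2 (n m : ℕ) (E U : Set (En n)) (hE : MeasurableSet E)
    (hfin : μH[m] E < ⊤) (hcl : μH[(m : ℝ) + 1] (closure E) = 0)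
    (hU : MeasurableSet U) (hUE : U ⊆ E) (hUpure : PurelyUnrectifiable n m U)
    (hUpos : 0 < μH[m] U) :
    ∀ ε : ℝ, 0 < ε → ENNReal.ofReal ε < μH[m] U / 4 →
      ∃ ψ : En n → En n,
        (∃ L : NNReal, LipschitzWith L ψ) ∧
        (∀ x, dist (ψ x) x < ε) ∧
        μH[m] (ψ '' E) < μH[m] E - μH[m] U / 2 := by
  intro ε hε _
  rcases le_or_gt n m with hnm | hmn
  · have h := hUpure univ (isRectifiable_univ_of_le hnm)
    rw [inter_univ] at h
    exact absurd h hUpos.ne'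
  set μ : Measure (En n) := μH[m].restrict E with hμ
  have hμfin : IsFiniteMeasure μ := ⟨by rwa [hμ, Measure.restrict_apply_univ]⟩
  have hμU : μ U = μH[m] U := Measure.restrict_eq_self _ hUE
  have hUtop : μH[m] U ≠ ⊤ := hμU ▸ measure_ne_top μ U
  obtain ⟨K, hKU, hK, hKlt⟩ := hU.exists_lt_isCompact_of_ne_top (μ := μ) (measure_ne_top μ U)
    (r := μH[m] U / 2) (by rw [hμU]; exact ENNReal.half_lt_self hUpos.ne' hUtop)
  have hμK : μ K = μH[m] K := Measure.restrict_eq_self _ (hKU.trans hUE)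
  have hKtop : μH[m] K ≠ ⊤ := hμK ▸ measure_ne_top μ K
  have hKne : K.Nonempty := by
    by_contra! h
    simp [h] at hKlt
  obtain ⟨C, hC, hdef⟩ := PurelyUnrectifiable.exists_deformation hmn (F := closure E)
    (fun F hF => measure_mono_null (inter_subset_inter_left F hKU) (hUpure F hF)) hK hKne
    ((hKU.trans hUE).trans subset_closure) hcl hKtop
  obtain ⟨η, hη, hηC⟩ := ENNReal.exists_nnreal_pos_mul_lt hC (tsub_pos_of_lt hKlt).ne'
  obtain ⟨V, hKV, hV, hVlt⟩ := K.exists_isOpen_lt_add (μ := μ) (measure_ne_top μ K)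
    (ENNReal.coe_pos.2 hη).ne'
  have hR : μH[m] (E ∩ (V \ K)) ≤ η := by
    rw [inter_comm, ← Measure.restrict_apply (hV.measurableSet.diff hK.measurableSet),
      measure_sdiff hKV hK.measurableSet.nullMeasurableSet (measure_ne_top μ K)]
    exact tsub_le_iff_left.2 hVlt.le
  obtain ⟨ψ, hL, hdist, hid, hnull, hle⟩ := hdef V hV hKV ε hε (E ∩ (V \ K))
    (inter_subset_left.trans subset_closure) (ne_top_of_le_ne_top ENNReal.coe_ne_top hR)
  refine ⟨ψ, hL, hdist, ?_⟩
  have hsplit : ψ '' E ⊆ (E \ V) ∪ (ψ '' K ∪ ψ '' (E ∩ (V \ K))) := by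
    rintro _ ⟨x, hx, rfl⟩
    by_cases hxV : x ∈ V
    · by_cases hxK : x ∈ K
      · exact Or.inr (Or.inl ⟨x, hxK, rfl⟩)
      · exact Or.inr (Or.inr ⟨x, ⟨hx, hxV, hxK⟩, rfl⟩)
    · exact Or.inl ((hid x hxV).symm ▸ ⟨hx, hxV⟩)
  have hbound : μH[m] (ψ '' E) ≤ μH[m] (E \ V) + η * C := by
    refine (measure_mono hsplit).trans ((measure_union_le _ _).trans ?_)
    gcongr
    refine (measure_union_le _ _).trans ?_
    rw [hnull, zero_add, mul_comm]
    exact hle.trans (by gcongr)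
  have hEVK : μH[m] (E \ V) + μH[m] K ≤ μH[m] E := by
    rw [← measure_union (disjoint_sdiff_left.mono_right hKV) hK.measurableSet]
    exact measure_mono (union_subset sdiff_subset (hKU.trans hUE))
  rw [lt_tsub_iff_right]
  calc μH[m] (ψ '' E) + μH[m] U / 2 ≤ μH[m] (E \ V) + (η * C + μH[m] U / 2) := by
        rw [← add_assoc]
        gcongr
    _ < μH[m] (E \ V) + μH[m] K := by
        refine ENNReal.add_lt_add_left (measure_ne_top_of_subset sdiff_subset hfin.ne) ?_
        rw [← hμK]
        exact lt_tsub_iff_right.1 hηC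
    _ ≤ μH[m] E := hEVK
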